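/- arXiv:1609.05136 — 4 statements merged into one kernel-verified Lean document; each statement's English description precedes it below -/
import Mathlib

section
/- For any continuous function f from the boundary C^n of the (n+1)-dimensional cross-polytope (the set of x in R^{n+1} with sum of |x_i| equal to 1) to R^n, there exists a point x in C^n such that f(x) = f(-x). -/
namespace BU

/-- Mod 2 chains on ordered tuples (lists). -/
abbrev Ch (α : Type*) := List α →₀ ZMod 2

noncomputable def lc {α β : Type*} [AddCommMonoid β] [Module (ZMod 2) β] (f : List α → β) :
    Ch α →ₗ[ZMod 2] β := Finsupp.linearCombination (ZMod 2) f

noncomputable def io {α : Type*} (l : List α) : Ch α := Finsupp.single l 1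

@[simp] lemma lc_io {α β : Type*} [AddCommMonoid β] [Module (ZMod 2) β] (f : List α → β)
    (l : List α) : lc f (io l) = f l := by
  simp [lc, io]

lemma lhom_ext {α β : Type*} [AddCommMonoid β] [Module (ZMod 2) β] {f g : Ch α →ₗ[ZMod 2] β}
    (h : ∀ l, f (io l) = g (io l)) : f = g := by
  apply Finsupp.lhom_ext'
  intro l
  apply LinearMap.ext_ring
  exact h l

lemma two_self {β : Type*} [AddCommGroup β] [Module (ZMod 2) β] (c : β) : c + c = 0 := by
  have h : ((1 : ZMod 2) + 1) • c = 0 := by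
    rw [show (1 : ZMod 2) + 1 = 0 by decide, zero_smul]
  rwa [add_smul, one_smul] at h

/-- Chains all of whose tuples satisfy `P`. -/
noncomputable def Sup {α : Type*} (P : List α → Prop) : Submodule (ZMod 2) (Ch α) :=
  Submodule.span (ZMod 2) {c | ∃ l, P l ∧ io l = c}

lemma io_mem {α : Type*} {P : List α → Prop} {l : List α} (h : P l) : io l ∈ Sup P :=
  Submodule.subset_span ⟨l, h, rfl⟩

lemma map_mem {α β : Type*} [AddCommMonoid β] [Module (ZMod 2) β] {P : List α → Prop}
    (f : Ch α →ₗ[ZMod 2] β) (S : Submodule (ZMod 2) β)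
    (h : ∀ l, P l → f (io l) ∈ S) {c : Ch α} (hc : c ∈ Sup P) : f c ∈ S := by
  have : Sup P ≤ S.comap f := by
    apply Submodule.span_le.2
    rintro _ ⟨l, hl, rfl⟩
    exact h l hl
  exact this hc

lemma map_eq {α β : Type*} [AddCommGroup β] [Module (ZMod 2) β] {P : List α → Prop}
    (f g : Ch α →ₗ[ZMod 2] β)
    (h : ∀ l, P l → f (io l) = g (io l)) {c : Ch α} (hc : c ∈ Sup P) : f c = g c := by
  have := map_mem (f - g) ⊥ (P := P) (fun l hl => by simp [h l hl]) hc
  simpa [sub_eq_zero] using this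

lemma Sup_mono {α : Type*} {P Q : List α → Prop} (h : ∀ l, P l → Q l) {c : Ch α}
    (hc : c ∈ Sup P) : c ∈ Sup Q :=
  map_mem LinearMap.id (Sup Q) (fun l hl => io_mem (h l hl)) hc

noncomputable def cn {α : Type*} (v : α) : Ch α →ₗ[ZMod 2] Ch α := lc (fun l => io (v :: l))

@[simp] lemma cn_io {α : Type*} (v : α) (l : List α) : cn v (io l) = io (v :: l) := by
  simp [cn]

noncomputable def d0 {α : Type*} : List α → Ch α
  | [] => 0
  | v :: l => io l + cn v (d0 l)

noncomputable def d {α : Type*} : Ch α →ₗ[ZMod 2] Ch α := lc d0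

@[simp] lemma d_io {α : Type*} (l : List α) : d (io l) = d0 l := by simp [d]

lemma d_cn {α : Type*} (v : α) (c : Ch α) : d (cn v c) = c + cn v (d c) := by
  have : d ∘ₗ cn v = LinearMap.id + cn v ∘ₗ d := by
    apply lhom_ext
    intro l
    simp [d0]
  exact LinearMap.congr_fun this c

lemma d_d {α : Type*} (c : Ch α) : d (d c) = 0 := by
  have : (d ∘ₗ d : Ch α →ₗ[ZMod 2] Ch α) = 0 := by
    apply lhom_ext
    intro l
    induction l with
    | nil => simp [d0]
    | cons v l ih =>
      simp only [LinearMap.comp_apply, d_io, LinearMap.zero_apply] at ih ⊢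
      simp only [d0, map_add, d_io, d_cn, ih, map_zero, add_zero]
      exact two_self _
  exact LinearMap.congr_fun this c

noncomputable def mp {α β : Type*} (f : α → β) : Ch α →ₗ[ZMod 2] Ch β :=
  lc (fun l => io (l.map f))

@[simp] lemma mp_io {α β : Type*} (f : α → β) (l : List α) : mp f (io l) = io (l.map f) := by
  simp [mp]

lemma mp_cn {α β : Type*} (f : α → β) (v : α) (c : Ch α) :
    mp f (cn v c) = cn (f v) (mp f c) := by
  have : mp f ∘ₗ cn v = cn (f v) ∘ₗ mp f := by
    apply lhom_ext
    intro l
    simp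
  exact LinearMap.congr_fun this c

lemma mp_d0 {α β : Type*} (f : α → β) (l : List α) : mp f (d0 l) = d0 (l.map f) := by
  induction l with
  | nil => simp [d0]
  | cons v l ih => simp [d0, mp_cn, ih]

lemma mp_d {α β : Type*} (f : α → β) (c : Ch α) : mp f (d c) = d (mp f c) := by
  have : mp f ∘ₗ d = d ∘ₗ mp f := by
    apply lhom_ext
    intro l
    simp [mp_d0]
  exact LinearMap.congr_fun this c

lemma d0_mem {α : Type*} (l : List α) :
    d0 l ∈ Sup (fun w => w.length + 1 = l.length ∧ w ⊆ l) := by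
  induction l with
  | nil => simp [d0]
  | cons v l ih =>
    refine Submodule.add_mem _ (io_mem ⟨by simp, by simp⟩) ?_
    refine map_mem _ _ ?_ ih
    rintro w ⟨h1, h2⟩
    rw [cn_io]
    exact io_mem ⟨by simp [h1], List.cons_subset_cons _ h2⟩

/-! ### The combinatorial cochain -/

/-- Alternating cochain on lists of labels (index, sign). -/
noncomputable def A : ℕ → Bool → List (ℕ × Bool) → ZMod 2
  | 0, _, l => if l = [] then 1 else 0
  | j + 1, s, l =>
    if l.countP (fun x => x.1 = j) = 0 then A j s l
    else if l.countP (fun x => x.1 = j) = 1 then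
      (if (j, s) ∈ l then A j (!s) (l.filter (fun x => x.1 ≠ j)) else 0)
    else 0

lemma A_perm (j : ℕ) : ∀ (s : Bool) {l l' : List (ℕ × Bool)}, l.Perm l' → A j s l = A j s l' := by
  induction j with
  | zero =>
    intro s l l' h
    have : l = [] ↔ l' = [] := ⟨fun e => by subst e; simpa using h, fun e => by subst e; simpa using h⟩
    simp [A, this]
  | succ j ih =>
    intro s l l' h
    simp only [A]
    rw [h.countP_eq, ih s h, ih (!s) (h.filter _)]
    simp only [h.mem_iff]

lemma A_vanish (j : ℕ) : ∀ (s : Bool) (l : List (ℕ × Bool)), j < l.length → A j s l = 0 := by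
  induction j with
  | zero =>
    intro s l h
    have : l ≠ [] := by rintro rfl; simp at h
    simp [A, this]
  | succ j ih =>
    intro s l h
    simp only [A]
    split_ifs with h1 h2 h3
    · exact ih _ _ (by omega)
    · apply ih
      have := List.length_eq_countP_add_countP (fun x : ℕ × Bool => decide (x.1 = j)) (l := l)
      rw [← List.countP_eq_length_filter]
      have e : List.countP (fun x : ℕ × Bool => decide (x.1 ≠ j)) l
        = List.countP (fun a => decide ¬decide (a.1 = j) = true) l := by
        congr 1; funext x; simp
      rw [e]; omega
    · rfl
    · rfl

def flip (x : ℕ × Bool) : ℕ × Bool := (x.1, !x.2)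

lemma A_flip (j : ℕ) : ∀ (s : Bool) (l : List (ℕ × Bool)), A j s (l.map flip) = A j (!s) l := by
  induction j with
  | zero => intro s l; simp [A]
  | succ j ih =>
    intro s l
    have hm : (j, s) ∈ l.map flip ↔ (j, !s) ∈ l := by
      constructor
      · intro h
        obtain ⟨⟨a, b⟩, hx, hy⟩ := List.mem_map.1 h
        simp only [flip, Prod.mk.injEq] at hy
        obtain ⟨rfl, rfl⟩ := hy
        simpa using hx
      · intro h
        exact List.mem_map.2 ⟨_, h, by simp [flip]⟩
    simp only [A, List.countP_map, List.filter_map, hm, ih]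
    rfl

/-- perm-invariant functionals see the boundary up to perm. -/
lemma d0_perm {α : Type*} {l l' : List α} (h : l.Perm l') :
    ∀ (F : List α → ZMod 2), (∀ a b : List α, a.Perm b → F a = F b) →
      lc F (d0 l) = lc F (d0 l') := by
  have key : ∀ (F : List α → ZMod 2) (v : α) (c : Ch α),
      lc F (cn v c) = lc (fun l => F (v :: l)) c := by
    intro F v c
    have : lc F ∘ₗ cn v = lc (fun l => F (v :: l)) := by
      apply lhom_ext; intro l; simp
    exact LinearMap.congr_fun this c
  induction h with
  | nil => intros; rfl
  | cons x h ih =>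
    intro F hF
    simp only [d0, map_add, lc_io, key]
    rw [hF _ _ h, ih _ (fun a b hab => hF _ _ (hab.cons x))]
  | swap x y l =>
    intro F hF
    simp only [d0, map_add, lc_io, key, cn_io]
    have : (fun l => F (x :: y :: l)) = fun l => F (y :: x :: l) := by
      funext l; exact hF _ _ (List.Perm.swap _ _ _)
    rw [this]; ring
  | trans _ _ h1 h2 => intro F hF; rw [h1 F hF, h2 F hF]

lemma lc_cn {α : Type*} (F : List α → ZMod 2) (v : α) (c : Ch α) :
      lc F (cn v c) = lc (fun l => F (v :: l)) c := by
  have : lc F ∘ₗ cn v = lc (fun l => F (v :: l)) := by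
    apply lhom_ext; intro l; simp
  exact LinearMap.congr_fun this c

lemma A_delta (j : ℕ) : ∀ (s : Bool) (l : List (ℕ × Bool)), (∀ x ∈ l, x.1 < j) →
    (∀ x ∈ l, flip x ∉ l) → lc (A j s) (d0 l) = A j s l + A j (!s) l := by
  induction j with
  | zero =>
    intro s l h _
    have : l = [] := List.eq_nil_iff_forall_not_mem.2 (fun x hx => by simpa using h x hx)
    subst this
    simp [d0, A]
    decide
  | succ j ih =>
    intro s l hlt hnc
    -- split off the top labels
    obtain ⟨t, r, hp, ht, hr⟩ : ∃ t r : List (ℕ × Bool), l.Perm (t ++ r) ∧ (∀ x ∈ t, x.1 = j) ∧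
        (∀ x ∈ r, x.1 < j) := by
      refine ⟨l.filter (fun x => x.1 = j), l.filter (fun x => !decide (x.1 = j)),
        (List.filter_append_perm _ _).symm, ?_, ?_⟩
      · intro x hx
        simpa using (List.mem_filter.1 hx).2
      · intro x hx
        have h1 := (List.mem_filter.1 hx).2
        have h2 := hlt x (List.mem_filter.1 hx).1
        simp at h1
        omega
    rw [d0_perm hp _ (fun a b => A_perm _ s), A_perm _ s hp, A_perm _ (!s) hp]
    replace hnc : ∀ x ∈ t ++ r, flip x ∉ t ++ r := by
      intro x hx
      rw [← hp.mem_iff] at hx ⊢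
      exact hnc x hx
    clear hp hlt l
    have cnt0 : ∀ w : List (ℕ × Bool), w ⊆ r → w.countP (fun x => x.1 = j) = 0 := by
      intro w hw
      apply List.countP_eq_zero.2
      intro x hx
      have := hr x (hw hx)
      simp; omega
    have A0 : ∀ (s : Bool) (w : List (ℕ × Bool)), w ⊆ r → A (j+1) s w = A j s w := by
      intro s w hw
      simp only [A, cnt0 w hw, if_true]
    match t, ht, hnc with
    | [], _, hnc =>
      simp only [List.nil_append] at hnc ⊢
      rw [A0 _ _ (List.Subset.refl _), A0 _ _ (List.Subset.refl _), ← ih s r hr hnc]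
      refine map_eq _ _ ?_ (d0_mem r)
      rintro w ⟨_, hw⟩
      simp only [lc_io]
      exact A0 _ _ hw
    | [(i, u)], ht, hnc =>
      have hi : i = j := ht (i, u) (by simp)
      subst hi
      simp only [List.singleton_append] at hnc ⊢
      have A1 : ∀ (s : Bool) (w : List (ℕ × Bool)), w ⊆ r →
          A (i+1) s ((i,u) :: w) = if u = s then A i (!s) w else 0 := by
        intro s w hw
        have h1 : ((i,u) :: w).countP (fun x => x.1 = i) = 1 := by
          rw [List.countP_cons, cnt0 w hw]; simp
        have h2 : ((i,u) :: w).filter (fun x => x.1 ≠ i) = w := by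
          rw [List.filter_cons]
          simp only [ne_eq, not_true, decide_false]
          apply List.filter_eq_self.2
          intro x hx
          have := hr x (hw hx)
          simp; omega
        have h3 : (i, s) ∈ (i,u) :: w ↔ u = s := by
          constructor
          · intro h
            rcases List.mem_cons.1 h with h | h
            · simp at h; exact h.symm
            · have := hr _ (hw h); simp at this
          · rintro rfl; simp
        simp only [A, h1, h2, h3]
        simp
      have hnc' : ∀ x ∈ r, flip x ∉ r := fun x hx h =>
        hnc x (List.mem_cons_of_mem _ hx) (List.mem_cons_of_mem _ h)
      simp only [d0, map_add, lc_io, lc_cn]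
      rw [A0 _ _ (List.Subset.refl _), A1 _ _ (List.Subset.refl _), A1 _ _ (List.Subset.refl _)]
      have e : lc (fun w => A (i+1) s ((i,u)::w)) (d0 r)
          = (if u = s then (1 : ZMod 2) else 0) * lc (A i (!s)) (d0 r) := by
        have := map_eq (lc (fun w => A (i+1) s ((i,u)::w)))
          ((if u = s then (1 : ZMod 2) else 0) • lc (A i (!s))) (c := d0 r) ?_ (d0_mem r)
        · rw [this, LinearMap.smul_apply, smul_eq_mul]
        · rintro w ⟨_, hw⟩
          simp only [lc_io, LinearMap.smul_apply, A1 s w hw]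
          split_ifs <;> simp
      rw [e, ih _ r hr hnc', Bool.not_not]
      have h2 := two_self (A i s r)
      by_cases hu : u = s
      · have : u ≠ !s := by subst hu; simp
        simp only [hu, if_true]
        rw [if_neg (by simp)]
        linear_combination h2
      · have : u = !s := by revert hu; cases u <;> cases s <;> simp
        simp [this]
    | x :: y :: t', ht, hnc =>
      have hx : x.1 = j := ht x (by simp)
      have hy : y.1 = j := ht y (by simp)
      have hxy : x = y := by
        by_contra hne
        apply hnc x (by simp)
        have : flip x = y := by
          obtain ⟨a, b⟩ := x
          obtain ⟨a', b'⟩ := y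
          simp only at hx hy
          subst hx; subst hy
          simp only [flip, Prod.mk.injEq, true_and] at hne ⊢
          revert hne; cases b <;> cases b' <;> simp
        rw [this]; simp
      subst hxy
      have A2 : ∀ (s : Bool) (w : List (ℕ × Bool)), A (j+1) s (x :: x :: w) = 0 := by
        intro s w
        simp only [A, List.countP_cons, hx]
        simp
      simp only [List.cons_append, d0, map_add, lc_io, lc_cn, A2, cn_io]
      have : lc (fun _ => (0 : ZMod 2)) (d0 (t' ++ r)) = 0 := by
        have : lc (fun _ : List (ℕ × Bool) => (0 : ZMod 2)) = 0 := by
          apply lhom_ext; intro l; simp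
        rw [this]; rfl
      rw [this, add_zero, two_self, add_zero]

/-! ### Barycentric subdivision -/

section sd

variable {E : Type*} [NormedAddCommGroup E] [NormedSpace ℝ E]

noncomputable def bary (l : List E) : E := ((l.length : ℝ)⁻¹) • l.sum

noncomputable def Sd : ℕ → (Ch E →ₗ[ZMod 2] Ch E)
  | 0 => LinearMap.id
  | k + 1 => lc (fun l => cn (bary l) (Sd k (d0 l)))

lemma d_Sd (k : ℕ) : ∀ c : Ch E, d (Sd (k + 1) c) = Sd k (d c) := by
  induction k with
  | zero =>
    intro c
    have : (d ∘ₗ Sd 1 : Ch E →ₗ[ZMod 2] Ch E) = Sd 0 ∘ₗ d := by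
      apply lhom_ext
      intro l
      simp only [LinearMap.comp_apply, Sd, lc_io, LinearMap.id_apply, d_io, d_cn]
      rw [← d_io l, d_d]; simp
    exact LinearMap.congr_fun this c
  | succ k ih =>
    intro c
    have : (d ∘ₗ Sd (k + 2) : Ch E →ₗ[ZMod 2] Ch E) = Sd (k + 1) ∘ₗ d := by
      apply lhom_ext
      intro l
      rw [LinearMap.comp_apply, Sd, lc_io, d_cn, ih, ← d_io l, d_d]; simp
    exact LinearMap.congr_fun this c

lemma bary_neg (l : List E) : bary (l.map (fun x => -x)) = - bary l := by
  have : (l.map (fun x => -x)).sum = - l.sum := by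
    induction l with
    | nil => simp
    | cons v l ih => simp [ih, add_comm]
  simp only [bary, List.length_map, this, smul_neg]

lemma mp_Sd (k : ℕ) : ∀ c : Ch E, mp (fun x => -x) (Sd k c) = Sd k (mp (fun x => -x) c) := by
  induction k with
  | zero => intro c; rfl
  | succ k ih =>
    intro c
    have : (mp (fun x => -x) ∘ₗ Sd (k + 1) : Ch E →ₗ[ZMod 2] Ch E)
        = Sd (k + 1) ∘ₗ mp (fun x => -x) := by
      apply lhom_ext
      intro l
      simp only [LinearMap.comp_apply, Sd, lc_io, mp_io, mp_cn, ih, bary_neg, mp_d0]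
    exact LinearMap.congr_fun this c

/-- Small simplices of length `k` in `K`. -/
def Sm (K : Set E) (D : ℝ) (k : ℕ) (l : List E) : Prop :=
  l.length = k ∧ (∀ v ∈ l, v ∈ K) ∧ ∀ v ∈ l, ∀ w ∈ l, dist v w ≤ D

lemma bary_mem (l : List E) (hl : l ≠ []) : bary l ∈ convexHull ℝ {v | v ∈ l} := by
  have hpos : (0 : ℝ) < l.length := by exact_mod_cast List.length_pos_iff.2 hl
  have : bary l = ∑ i : Fin l.length, ((l.length : ℝ)⁻¹) • l.get i := by
    rw [← Finset.smul_sum, bary]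
    congr 1
    conv_lhs => rw [← List.ofFn_get l]
    rw [List.sum_ofFn]
  rw [this]
  apply (convex_convexHull ℝ _).sum_mem
  · intros; positivity
  · simp; field_simp
  · intro i _
    exact subset_convexHull _ _ (List.get_mem l i)

lemma bary_dist (l : List E) (D : ℝ) (v : E) (hv : v ∈ l) (h : ∀ w ∈ l, dist v w ≤ D) :
    dist (bary l) v ≤ (1 - (l.length : ℝ)⁻¹) * D := by
  have hl : l ≠ [] := by rintro rfl; simp at hv
  have hpos : (0 : ℝ) < l.length := by exact_mod_cast List.length_pos_iff.2 hl
  have e : bary l - v = (l.length : ℝ)⁻¹ • (l.map (fun w => w - v)).sum := by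
    have : (l.map (fun w => w - v)).sum = l.sum - (l.length : ℝ) • v := by
      clear hv h hl hpos
      induction l with
      | nil => simp
      | cons a l ih => simp [ih, add_smul]; abel
    rw [this, smul_sub, smul_smul, inv_mul_cancel₀ hpos.ne', one_smul, bary]
  have hs : ∀ l : List E, (∀ w ∈ l, dist v w ≤ D) →
      ‖(l.map (fun w => w - v)).sum‖ ≤ l.length * D := by
    intro l h
    induction l with
    | nil => simp
    | cons a l ih =>
      simp only [List.map_cons, List.sum_cons, List.length_cons]
      have h1 := h a (by simp)
      rw [dist_comm, dist_eq_norm] at h1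
      have h2 := ih (fun w hw => h w (by simp [hw]))
      push_cast
      linarith [norm_add_le (a - v) (l.map (fun w => w - v)).sum]
  obtain ⟨l1, l2, rfl⟩ := List.append_of_mem hv
  rw [dist_eq_norm, e, norm_smul, Real.norm_of_nonneg (by positivity)]
  have h1 := hs (l1 ++ l2) (fun w hw => h w (by simp at hw ⊢; tauto))
  have h2 : ((l1 ++ v :: l2).map (fun w => w - v)).sum = ((l1 ++ l2).map (fun w => w - v)).sum := by
    simp
  rw [h2]
  have h3 : ((l1 ++ v :: l2).length : ℝ) = (l1 ++ l2).length + 1 := by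
    simp; ring
  rw [h3] at hpos ⊢
  calc _ ≤ (((l1 ++ l2).length : ℝ) + 1)⁻¹ * ((l1 ++ l2).length * D) := by gcongr
    _ = _ := by field_simp; ring

lemma Sd_small (N : ℕ) (hN : 0 < N) (D : ℝ) (hD : 0 ≤ D) (k : ℕ) : ∀ (_ : k ≤ N) (K : Set E)
    (_ : Convex ℝ K) (l : List E), Sm K D k l →
    Sd k (io l) ∈ Sup (Sm K ((1 - (N : ℝ)⁻¹) * D) k) := by
  induction k with
  | zero =>
    intro _ K _ l h
    have : l = [] := List.length_eq_zero_iff.1 h.1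
    subst this
    exact io_mem ⟨rfl, by simp, by simp⟩
  | succ k ih =>
    intro hk K hK l h
    obtain ⟨h1, h2, h3⟩ := h
    have hl : l ≠ [] := by rintro rfl; simp at h1
    have hpos : (0 : ℝ) < l.length := by exact_mod_cast List.length_pos_iff.2 hl
    set K' := convexHull ℝ {v | v ∈ l} with hK'
    have hKK : K' ⊆ K := convexHull_min h2 hK
    have hr : (1 - (l.length : ℝ)⁻¹) * D ≤ (1 - (N : ℝ)⁻¹) * D := by
      gcongr
      omega
    have hr0 : 0 ≤ (1 - (N : ℝ)⁻¹) * D := by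
      apply mul_nonneg _ hD
      rw [sub_nonneg]
      apply inv_le_one_of_one_le₀
      exact_mod_cast hN
    have hb : ∀ y ∈ K', dist y (bary l) ≤ (1 - (N : ℝ)⁻¹) * D := by
      intro y hy
      have : K' ⊆ Metric.closedBall (bary l) ((1 - (N : ℝ)⁻¹) * D) := by
        apply convexHull_min _ (convex_closedBall _ _)
        intro v hv
        rw [Metric.mem_closedBall, dist_comm]
        exact (bary_dist l D v hv (h3 v hv)).trans hr
      exact this hy
    have hbm : bary l ∈ K' := bary_mem l hl
    rw [Sd, lc_io]
    have hd : Sd k (d0 l) ∈ Sup (Sm K' ((1 - (N : ℝ)⁻¹) * D) k) := by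
      refine map_mem _ _ ?_ (d0_mem l)
      rintro w ⟨hw1, hw2⟩
      exact ih (by omega) K' (convex_convexHull ℝ _) w ⟨by omega,
        fun v hv => subset_convexHull ℝ _ (hw2 hv), fun v hv u hu => h3 v (hw2 hv) u (hw2 hu)⟩
    refine map_mem _ _ ?_ hd
    rintro w ⟨hw1, hw2, hw3⟩
    rw [cn_io]
    refine io_mem ⟨by simp [hw1], ?_, ?_⟩
    · intro v hv
      rcases List.mem_cons.1 hv with rfl | hv
      · exact hKK hbm
      · exact hKK (hw2 v hv)
    · intro v hv u hu
      rcases List.mem_cons.1 hv with rfl | hv <;> rcases List.mem_cons.1 hu with rfl | hu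
      · simpa using hr0
      · rw [dist_comm]; exact hb _ (hw2 u hu)
      · exact hb _ (hw2 v hv)
      · exact hw3 v hv u hu

/-- Small simplices of length `k` inside some convex subset of `X`. -/
def Sx (X : Set E) (D : ℝ) (k : ℕ) (l : List E) : Prop :=
  ∃ K : Set E, Convex ℝ K ∧ K ⊆ X ∧ Sm K D k l

lemma Sd_iter (N : ℕ) (hN : 0 < N) (X : Set E) (D : ℝ) (hD : 0 ≤ D) (k : ℕ) (hk : k ≤ N)
    (m : ℕ) (c : Ch E) (hc : c ∈ Sup (Sx X D k)) :
    (Sd k)^[m] c ∈ Sup (Sx X ((1 - (N : ℝ)⁻¹) ^ m * D) k) := by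
  induction m with
  | zero => simpa using hc
  | succ m ih =>
    rw [Function.iterate_succ_apply']
    refine map_mem _ _ ?_ ih
    rintro l ⟨K, hK, hKX, hl⟩
    have h0 : 0 ≤ 1 - (N : ℝ)⁻¹ := by
      rw [sub_nonneg]
      apply inv_le_one_of_one_le₀
      exact_mod_cast hN
    have := Sd_small N hN _ (by positivity) k hk K hK l hl
    refine Sup_mono ?_ this
    intro w hw
    refine ⟨K, hK, hKX, ?_⟩
    rw [pow_succ', mul_assoc]
    exact hw

end sd

/-! ### The cross-polytope -/

def C (n : ℕ) : Set (Fin (n + 1) → ℝ) := {x | ∑ i, |x i| = 1}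

def e (n k : ℕ) : Fin (n + 1) → ℝ := fun i => if (i : ℕ) = k then 1 else 0

noncomputable def hs (n : ℕ) : ℕ → Ch (Fin (n + 1) → ℝ)
  | 0 => io []
  | k + 1 => cn (e n k) (hs n k) + cn (-e n k) (hs n k)

lemma d_hs (n k : ℕ) : d (hs n k) = 0 := by
  induction k with
  | zero => simp [hs, d0]
  | succ k ih => simp [hs, d_cn, ih, two_self]

lemma mp_hs (n k : ℕ) : mp (fun x => -x) (hs n k) = hs n k := by
  induction k with
  | zero => simp [hs]
  | succ k ih => simp [hs, mp_cn, ih, add_comm]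

def Fc (n : ℕ) (ε : Fin (n + 1) → ℝ) : Set (Fin (n + 1) → ℝ) :=
  {x | (∀ i, 0 ≤ ε i * x i) ∧ ∑ i, ε i * x i = 1}

lemma Fc_convex (n : ℕ) (ε : Fin (n + 1) → ℝ) : Convex ℝ (Fc n ε) := by
  intro x hx y hy a b ha hb hab
  refine ⟨fun i => ?_, ?_⟩
  · have h1 := mul_nonneg ha (hx.1 i)
    have h2 := mul_nonneg hb (hy.1 i)
    simp only [Pi.add_apply, Pi.smul_apply, smul_eq_mul]
    nlinarith
  · have : ∀ i, ε i * (a • x + b • y) i = a * (ε i * x i) + b * (ε i * y i) := by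
      intro i; simp only [Pi.add_apply, Pi.smul_apply, smul_eq_mul]; ring
    simp only [this, Finset.sum_add_distrib, ← Finset.mul_sum, hx.2, hy.2]
    linarith

lemma Fc_sub (n : ℕ) (ε : Fin (n + 1) → ℝ) (hε : ∀ i, |ε i| = 1) : Fc n ε ⊆ C n := by
  intro x hx
  rw [C, Set.mem_ofPred_eq, ← hx.2]
  refine Finset.sum_congr rfl fun i _ => ?_
  rw [← abs_of_nonneg (hx.1 i), abs_mul, hε, one_mul]

lemma hs_mem (n k : ℕ) (hk : k ≤ n + 1) : hs n k ∈ Sup (fun l => l.length = k ∧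
    ∃ ε : Fin (n + 1) → ℝ, (∀ i, |ε i| = 1) ∧
      ∀ v ∈ l, v ∈ Fc n ε ∧ ∀ i : Fin (n + 1), k ≤ i → v i = 0) := by
  induction k with
  | zero => exact io_mem ⟨rfl, fun _ => 1, by simp, by simp⟩
  | succ k ih =>
    have key : ∀ σ : ℝ, |σ| = 1 → cn (σ • e n k) (hs n k) ∈ Sup (fun l => l.length = k + 1 ∧
        ∃ ε : Fin (n + 1) → ℝ, (∀ i, |ε i| = 1) ∧
      ∀ v ∈ l, v ∈ Fc n ε ∧ ∀ i : Fin (n + 1), k + 1 ≤ i → v i = 0) := by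
      intro σ hσ
      have hσ2 : σ * σ = 1 := by rw [← abs_mul_abs_self, hσ]; norm_num
      refine map_mem _ _ ?_ (ih (by omega))
      rintro l ⟨hl, ε, hε, hv⟩
      rw [cn_io]
      refine io_mem ⟨by simp [hl], Function.update ε ⟨k, by omega⟩ σ, ?_, ?_⟩
      · intro i
        by_cases hi : i = ⟨k, by omega⟩
        · subst hi; simpa using hσ
        · simpa [Function.update_of_ne hi] using hε i
      · intro v hvm
        rcases List.mem_cons.1 hvm with rfl | hvm
        · have : ∀ i, Function.update ε ⟨k, by omega⟩ σ i * (σ • e n k) i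
              = if i = ⟨k, by omega⟩ then 1 else 0 := by
            intro i
            by_cases hi : i = ⟨k, by omega⟩
            · subst hi; simp [e, hσ2]
            · have : (i : ℕ) ≠ k := fun h => hi (Fin.ext h)
              simp [e, hi, this]
          refine ⟨⟨?_, ?_⟩, ?_⟩
          · intro i; rw [this]; split_ifs <;> norm_num
          · simp only [this]; simp
          · intro i hi
            have : (i : ℕ) ≠ k := by omega
            simp [e, this]
        · obtain ⟨⟨h1, h2⟩, h3⟩ := hv v hvm
          have : ∀ i, Function.update ε ⟨k, by omega⟩ σ i * v i = ε i * v i := by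
            intro i
            by_cases hi : i = ⟨k, by omega⟩
            · rw [h3 i (by subst hi; simp)]; simp
            · rw [Function.update_of_ne hi]
          refine ⟨⟨?_, ?_⟩, fun i hi => h3 i (by omega)⟩
          · intro i; rw [this]; exact h1 i
          · simp only [this]; exact h2
    refine Submodule.add_mem _ ?_ ?_
    · simpa using key 1 (by simp)
    · simpa using key (-1) (by simp)


lemma hs_mem' (n k : ℕ) (hk : k ≤ n + 1) (D : ℝ)
    (hD : ∀ x ∈ C n, ∀ y ∈ C n, dist x y ≤ D) : hs n k ∈ Sup (Sx (C n) D k) := by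
  refine Sup_mono ?_ (hs_mem n k hk)
  rintro l ⟨hl, ε, hε, h⟩
  have hsub := Fc_sub n ε hε
  exact ⟨Fc n ε, Fc_convex n ε, hsub, hl, fun v hv => (h v hv).1,
    fun v hv w hw => hD v (hsub (h v hv).1) w (hsub (h w hw).1)⟩

lemma cone_mem (n k : ℕ) (hk : k + 1 ≤ n + 1) (D : ℝ)
    (hD : ∀ x ∈ C n, ∀ y ∈ C n, dist x y ≤ D) :
    cn (e n k) (hs n k) ∈ Sup (Sx (C n) D (k + 1)) := by
  refine map_mem _ _ ?_ (hs_mem n k (by omega))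
  rintro l ⟨hl, ε, hε, hv⟩
  have hσ : |(1 : ℝ)| = 1 := by simp
  rw [cn_io]
  set ε' := Function.update ε ⟨k, by omega⟩ 1 with hε'
  have h1 : ∀ i, |ε' i| = 1 := by
    intro i
    by_cases hi : i = ⟨k, by omega⟩
    · subst hi; simp [hε']
    · simpa [hε', Function.update_of_ne hi] using hε i
  have hsub := Fc_sub n ε' h1
  have hm : ∀ v ∈ e n k :: l, v ∈ Fc n ε' := by
    intro v hvm
    rcases List.mem_cons.1 hvm with rfl | hvm
    · have : ∀ i, ε' i * e n k i = if i = ⟨k, by omega⟩ then 1 else 0 := by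
        intro i
        by_cases hi : i = ⟨k, by omega⟩
        · subst hi; simp [e, hε']
        · have : (i : ℕ) ≠ k := fun h => hi (Fin.ext h)
          simp [e, hi, this]
      refine ⟨?_, ?_⟩
      · intro i; rw [this]; split_ifs <;> norm_num
      · simp only [this]; simp
    · obtain ⟨⟨h1, h2⟩, h3⟩ := hv v hvm
      have : ∀ i, ε' i * v i = ε i * v i := by
        intro i
        by_cases hi : i = ⟨k, by omega⟩
        · rw [h3 i (by subst hi; simp)]; simp
        · rw [hε', Function.update_of_ne hi]
      refine ⟨?_, ?_⟩
      · intro i; rw [this]; exact h1 i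
      · simp only [this]; exact h2
  exact io_mem ⟨Fc n ε', Fc_convex n ε', hsub, by simp [hl], hm,
    fun v hv w hw => hD v (hsub (hm v hv)) w (hsub (hm w hw))⟩

/-- Tucker type lemma. -/
lemma tucker (n : ℕ) (η : ℝ) (hη : 0 < η) (D : ℝ)
    (hD : ∀ x ∈ C n, ∀ y ∈ C n, dist x y ≤ D) (hD0 : 0 ≤ D)
    (lab : (Fin (n + 1) → ℝ) → ℕ × Bool)
    (hlt : ∀ x ∈ C n, (lab x).1 < n) (hneg : ∀ x ∈ C n, lab (-x) = flip (lab x))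
    (hnc : ∀ x ∈ C n, ∀ y ∈ C n, dist x y < η → lab y ≠ flip (lab x)) : False := by
  have hN : (0 : ℝ) < ((n + 1 : ℕ) : ℝ) := by positivity
  have hρ1 : 1 - ((n + 1 : ℕ) : ℝ)⁻¹ < 1 := by
    have : 0 < ((n + 1 : ℕ) : ℝ)⁻¹ := by positivity
    linarith
  have hρ0 : 0 ≤ 1 - ((n + 1 : ℕ) : ℝ)⁻¹ := by
    rw [sub_nonneg]
    apply inv_le_one_of_one_le₀
    exact_mod_cast Nat.succ_pos n
  obtain ⟨m, hm⟩ : ∃ m : ℕ, (1 - ((n + 1 : ℕ) : ℝ)⁻¹) ^ m * D < η := by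
    obtain ⟨m, hm⟩ := exists_pow_lt_of_lt_one (show 0 < η / (D + 1) by positivity) hρ1
    refine ⟨m, ?_⟩
    rw [lt_div_iff₀ (by positivity)] at hm
    have := pow_nonneg hρ0 m
    nlinarith
  set φ : Bool → Ch (Fin (n + 1) → ℝ) →ₗ[ZMod 2] ZMod 2 :=
    fun s => lc (A n s) ∘ₗ mp lab with hφ
  have good : ∀ k, ∀ l, Sx (C n) ((1 - ((n + 1 : ℕ) : ℝ)⁻¹) ^ m * D) k l →
      l.length = k ∧ (∀ v ∈ l, v ∈ C n) ∧ ∀ v ∈ l, ∀ w ∈ l, dist v w < η := by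
    rintro k l ⟨K, hK, hKC, h1, h2, h3⟩
    exact ⟨h1, fun v hv => hKC (h2 v hv), fun v hv w hw => (h3 v hv w hw).trans_lt hm⟩
  have main : ∀ k, k ≤ n + 1 → φ true ((Sd k)^[m] (hs n k)) = 1 := by
    intro k
    induction k with
    | zero =>
      intro _
      have : (Sd 0)^[m] (hs n 0) = io [] := by
        have : (Sd 0 : Ch (Fin (n + 1) → ℝ) →ₗ[ZMod 2] _)^[m] = id := by
          have : ((Sd 0 : Ch (Fin (n + 1) → ℝ) →ₗ[ZMod 2] _) : _ → _) = id := rfl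
          rw [this, Function.iterate_id]
        rw [this]; rfl
      rw [this]
      simp only [hφ, LinearMap.comp_apply, mp_io, lc_io, List.map_nil]
      have : ∀ (j : ℕ) (s : Bool), A j s [] = 1 := by
        intro j
        induction j with
        | zero => intro s; simp [A]
        | succ j ih => intro s; simp [A, ih]
      exact this _ _
    | succ k ih =>
      intro hk
      set H := (Sd (k + 1))^[m] (cn (e n k) (hs n k)) with hH
      have hHm := Sd_iter (n + 1) (Nat.succ_pos n) (C n) D hD0 (k + 1) hk m _
        (cone_mem n k hk D hD)
      have hdH : d H = (Sd k)^[m] (hs n k) := by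
        have sc : Function.Semiconj (d : Ch (Fin (n + 1) → ℝ) →ₗ[ZMod 2] _) (Sd (k + 1)) (Sd k) :=
          fun c => d_Sd k c
        rw [hH, (sc.iterate_right m).eq, d_cn, d_hs]
        simp
      have hsplit : (Sd (k + 1))^[m] (hs n (k + 1)) = H + mp (fun x => -x) H := by
        have sc : Function.Semiconj (mp (fun x => -x) : Ch (Fin (n + 1) → ℝ) →ₗ[ZMod 2] _)
          (Sd (k + 1)) (Sd (k + 1)) := fun c => mp_Sd (k + 1) c
        rw [hH, (sc.iterate_right m).eq, mp_cn, mp_hs, hs, iterate_map_add]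
      rw [hsplit, map_add]
      have hν : φ true (mp (fun x => -x) H) = φ false H := by
        refine map_eq (φ true ∘ₗ mp (fun x => -x)) (φ false) ?_ hHm
        intro l hl
        obtain ⟨-, hl, -⟩ := good _ _ hl
        simp only [hφ, LinearMap.comp_apply, mp_io, lc_io]
        rw [show false = !true from rfl, ← A_flip, List.map_map, List.map_map]
        congr 1
        apply List.map_congr_left
        intro x hx
        exact hneg x (hl x hx)
      have hδ : φ true (d H) = φ true H + φ false H := by
        refine map_eq (φ true ∘ₗ d) (φ true + φ false) ?_ hHm
        intro l hl
        obtain ⟨-, hl, hl2⟩ := good _ _ hl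
        simp only [hφ, LinearMap.comp_apply, LinearMap.add_apply, mp_io, lc_io, d_io, mp_d0]
        apply A_delta
        · intro x hx
          obtain ⟨v, hv, rfl⟩ := List.mem_map.1 hx
          exact hlt v (hl v hv)
        · intro x hx hx'
          obtain ⟨v, hv, rfl⟩ := List.mem_map.1 hx
          obtain ⟨w, hw, hw'⟩ := List.mem_map.1 hx'
          exact hnc v (hl v hv) w (hl w hw) (hl2 v hv w hw) hw'
      rw [hν, ← hδ, hdH]
      exact ih (by omega)
  have h1 := main (n + 1) le_rfl
  have h0 : φ true ((Sd (n + 1))^[m] (hs n (n + 1))) = 0 := by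
    refine map_eq (φ true) 0 ?_ (Sd_iter (n + 1) (Nat.succ_pos n) (C n) D hD0 (n + 1) le_rfl m _
      (hs_mem' n (n + 1) le_rfl D hD))
    intro l hl
    obtain ⟨hl, -, -⟩ := good _ _ hl
    simp only [hφ, LinearMap.comp_apply, mp_io, lc_io, LinearMap.zero_apply]
    apply A_vanish
    simp [hl]
  rw [h0] at h1
  exact absurd h1 (by decide)

lemma C_compact (n : ℕ) : IsCompact (C n) := by
  apply Metric.isCompact_of_isClosed_isBounded
  · exact isClosed_eq (by fun_prop) continuous_const
  · refine (Metric.isBounded_closedBall (x := (0 : Fin (n + 1) → ℝ)) (r := 1)).subset ?_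
    intro x hx
    rw [mem_closedBall_zero_iff, pi_norm_le_iff_of_nonneg zero_le_one]
    intro i
    have hx' : ∑ i, |x i| = 1 := hx
    rw [Real.norm_eq_abs, ← hx']
    exact Finset.single_le_sum (f := fun i => |x i|) (fun i _ => abs_nonneg _) (Finset.mem_univ i)

lemma C_neg {n : ℕ} {x : Fin (n + 1) → ℝ} (hx : x ∈ C n) : -x ∈ C n := by
  have hx' : ∑ i, |x i| = 1 := hx
  change ∑ i, |(-x) i| = 1
  simpa using hx'

lemma main (n : ℕ) (f : (Fin (n + 1) → ℝ) → (Fin n → ℝ)) (hf : ContinuousOn f (C n)) :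
    ∃ x ∈ C n, f x = f (-x) := by
  by_contra! hcon
  set g : (Fin (n + 1) → ℝ) → (Fin n → ℝ) := fun x => f x - f (-x) with hg
  have hgc : ContinuousOn g (C n) :=
    hf.sub (hf.comp continuous_neg.continuousOn (fun x hx => C_neg hx))
  have hgn : ∀ x, g (-x) = - g x := by intro x; simp [hg]
  have hg0 : ∀ x ∈ C n, g x ≠ 0 := fun x hx => sub_ne_zero.2 (hcon x hx)
  have hne : (C n).Nonempty := by
    refine ⟨e n 0, ?_⟩
    change ∑ i, |e n 0 i| = 1
    have : ∀ i : Fin (n + 1), |e n 0 i| = if i = 0 then 1 else 0 := by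
      intro i
      by_cases hi : i = 0
      · simp [e, hi]
      · have : (i : ℕ) ≠ 0 := fun h => hi (Fin.ext h)
        simp [e, hi]
    simp [this]
  obtain ⟨x0, hx0, hmin⟩ := (C_compact n).exists_isMinOn hne hgc.norm
  set δ := ‖g x0‖ with hδ
  have hδ0 : 0 < δ := norm_pos_iff.2 (hg0 x0 hx0)
  have hle : ∀ x ∈ C n, δ ≤ ‖g x‖ := fun x hx => hmin hx
  obtain ⟨η, hη, huc⟩ := Metric.uniformContinuousOn_iff.1
    ((C_compact n).uniformContinuousOn_of_continuous hgc) δ hδ0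
  obtain ⟨D, hD⟩ := Metric.isBounded_iff.1 (C_compact n).isBounded
  have hD0 : 0 ≤ D := by simpa using hD hx0 hx0
  -- labels
  set P : (Fin (n + 1) → ℝ) → ℕ → Prop := fun x j => ∃ h : j < n, δ ≤ |g x ⟨j, h⟩| with hP
  have hPn : ∀ x, P (-x) = P x := by
    intro x; funext j; simp [hP, hgn]
  have hPe : ∀ x ∈ C n, ∃ j, P x j := by
    intro x hx
    by_contra! h
    have : ‖g x‖ < δ := by
      rw [pi_norm_lt_iff hδ0]
      intro i
      by_contra hi
      exact h i ⟨i.2, by simpa using hi⟩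
    linarith [hle x hx]
  set ix : (Fin (n + 1) → ℝ) → ℕ := fun x => Classical.epsilon (P x) with hix
  have hixs : ∀ x ∈ C n, P x (ix x) := fun x hx => Classical.epsilon_spec (hPe x hx)
  have hixn : ∀ x, ix (-x) = ix x := by intro x; simp only [hix, hPn]
  set G : (Fin (n + 1) → ℝ) → ℕ → ℝ := fun x j => if h : j < n then g x ⟨j, h⟩ else 0 with hG
  have hGn : ∀ x j, G (-x) j = - G x j := by
    intro x j; simp only [hG]; split_ifs <;> simp [hgn]
  have hGb : ∀ x ∈ C n, δ ≤ |G x (ix x)| := by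
    intro x hx
    obtain ⟨h, h'⟩ := hixs x hx
    simpa only [hG, h, dif_pos] using h'
  have hGd : ∀ x y j, |G x j - G y j| ≤ dist (g x) (g y) := by
    intro x y j
    simp only [hG]
    split_ifs with h
    · exact dist_le_pi_dist (g x) (g y) ⟨j, h⟩
    · simp
  classical
  refine tucker n η hη D (fun x hx y hy => hD hx hy) hD0
    (fun x => (ix x, decide (0 < G x (ix x)))) ?_ ?_ ?_
  · intro x hx
    exact (hixs x hx).1
  · intro x hx
    have := hGb x hx
    have h0 : G x (ix x) ≠ 0 := by
      intro h; rw [h, abs_zero] at this; linarith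
    simp only [flip, hixn, hGn, Prod.mk.injEq, true_and]
    rcases lt_or_gt_of_ne h0 with h | h
    · simp [h, h.le]
    · simp [h, h.le]
  · intro x hx y hy hxy heq
    simp only [flip, Prod.mk.injEq] at heq
    obtain ⟨h1, h2⟩ := heq
    have hbx := hGb x hx
    have hby := hGb y hy
    rw [h1] at h2 hby
    have hd := (hGd x y (ix x)).trans_lt (huc x hx y hy hxy)
    rw [abs_lt] at hd
    by_cases hp : 0 < G x (ix x)
    · have hq : ¬ 0 < G y (ix x) := by simpa [hp] using h2
      rw [abs_of_pos hp] at hbx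
      linarith
    · have hq : 0 < G y (ix x) := by simpa [hp] using h2
      rw [abs_of_pos hq] at hby
      linarith

end BU


/-- **Borsuk–Ulam on the cross-polytope boundary.** For any continuous function `f`
from `C^n = {x ∈ ℝ^{n+1} : Σ|xᵢ| = 1}` to `ℝ^n`, there is `x ∈ C^n` with `f x = f (-x)`. -/
theorem borsuk_ulam_cross_polytope (n : ℕ)
    (f : (Fin (n + 1) → ℝ) → (Fin n → ℝ))
    (hf : ContinuousOn f {x : Fin (n + 1) → ℝ | ∑ i, |x i| = 1}) :
    ∃ x ∈ {x : Fin (n + 1) → ℝ | ∑ i, |x i| = 1}, f x = f (-x) := by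
  exact BU.main n f hf
end

section
/- Let μ_1, ..., μ_n be probability measures on [0,1], each absolutely continuous with density bounded by M, and let ε > 0. Then there exist n cut points 0 ≤ t_1 ≤ ... ≤ t_n ≤ 1 and a labeling of the resulting n+1 intervals by {+,-} such that |μ_i(O_+) - μ_i(O_-)| ≤ ε for every agent i, where O_+ and O_- are the unions of the intervals with the respective labels. -/
open MeasureTheory

set_option linter.unusedSectionVars false

namespace CH

/-- Coboundary of a mod-2 cochain `f`, evaluated on an ordered simplex. -/
def D {α : Type*} : List α → (List α → ZMod 2) → ZMod 2
  | [], _ => 0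
  | a :: l, f => f l + D l (fun m => f (a :: m))

lemma D_congr {α : Type*} : ∀ (l : List α) (f g : List α → ZMod 2),
    (∀ m, m.Sublist l → m.length + 1 = l.length → f m = g m) → D l f = D l g
  | [], _, _, _ => rfl
  | a :: l, f, g, h => by
    simp only [D]
    rw [h l (List.sublist_cons_self a l) (by simp)]
    congr 1
    apply D_congr
    intro m hm hl
    exact h _ (hm.cons_cons a) (by simp [hl])

lemma D_add {α : Type*} : ∀ (l : List α) (f g : List α → ZMod 2),
    D l (fun m => f m + g m) = D l f + D l g
  | [], _, _ => by simp [D]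
  | a :: l, f, g => by
    simp only [D]
    rw [D_add l]
    ring

lemma D_D {α : Type*} : ∀ (l : List α) (f : List α → ZMod 2),
    D l (fun m => D m f) = 0
  | [], _ => by simp [D]
  | a :: l, f => by
    simp only [D]
    rw [D_add l, D_D l, add_zero]
    exact CharTwo.add_self_eq_zero _

lemma D_map {α β : Type*} (g : α → β) : ∀ (l : List α) (f : List β → ZMod 2),
    D (l.map g) f = D l (fun m => f (m.map g))
  | [], _ => by simp [D]
  | a :: l, f => by
    simp only [D, List.map_cons]
    rw [D_map g l]

lemma D_perm {α : Type*} {l l' : List α} (h : l.Perm l') :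
    ∀ (f : List α → ZMod 2), (∀ m m', m.Perm m' → f m = f m') → D l f = D l' f := by
  induction h with
  | nil => intros; rfl
  | cons a h ih =>
    intro f hf
    simp only [D]
    rw [hf _ _ h, ih _ (fun m m' hm => hf _ _ (hm.cons a))]
  | swap a b l =>
    intro f hf
    simp only [D]
    have : (fun m => f (b :: a :: m)) = (fun m => f (a :: b :: m)) := by
      funext m
      exact hf _ _ (List.Perm.swap a b m)
    rw [this]
    ring
  | trans _ _ ih1 ih2 => intro f hf; rw [ih1 f hf, ih2 f hf]

/-- indicator of alternating parities -/
def psi : Bool → List ℕ → ZMod 2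
  | _, [] => 1
  | s, a :: l => if a.bodd = s then psi (!s) l else 0

lemma D_psi : ∀ (l : List ℕ) (s : Bool), D l (psi s) = psi s l + psi (!s) l
  | [], s => by simp only [D, psi]; decide
  | a :: l, s => by
    simp only [D, psi]
    by_cases h : a.bodd = s
    · have h' : ¬ a.bodd = !s := by rw [h]; cases s <;> simp
      simp only [h, if_true]
      rw [D_psi l (!s)]
      have := CharTwo.add_self_eq_zero (psi s l)
      cases s <;> simp_all <;> linear_combination this
    · have h' : a.bodd = !s := by cases s <;> simp_all
      simp only [h, if_false]
      have : D l (fun _ => (0 : ZMod 2)) = 0 := by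
        have := D_add l (fun _ => 0) (fun _ => 0)
        simpa using this
      rw [this]
      simp [h']

/-- flip the sign of a label -/
def flip (a : ℕ) : ℕ := if a % 2 = 0 then a + 1 else a - 1

def phi (s : Bool) (l : List ℕ) : ZMod 2 := psi s (l.insertionSort (· ≤ ·))

lemma phi_perm (s : Bool) (m m' : List ℕ) (h : m.Perm m') : phi s m = phi s m' := by
  unfold phi
  congr 1
  apply List.Perm.eq_of_pairwise (le := (· ≤ ·))
  · intro a b _ _ h1 h2; exact le_antisymm h1 h2
  · exact List.pairwise_insertionSort _ _
  · exact List.pairwise_insertionSort _ _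
  · exact ((List.perm_insertionSort _ m).trans h).trans (List.perm_insertionSort _ m').symm

lemma D_phi (s : Bool) (l : List ℕ) : D l (phi s) = phi s l + phi (!s) l := by
  rw [← D_perm (List.perm_insertionSort (· ≤ ·) l) _ (phi_perm s)]
  rw [D_congr _ (phi s) (psi s), D_psi]
  · rfl
  · intro m hm _
    unfold phi
    rw [List.Pairwise.insertionSort_eq]
    exact (List.pairwise_insertionSort (· ≤ ·) l).sublist hm

def NC (l : List ℕ) : Prop := ∀ a ∈ l, ∀ b ∈ l, a / 2 = b / 2 → a = b

lemma flip_bodd (a : ℕ) : (flip a).bodd = !a.bodd := by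
  unfold flip
  split_ifs with h
  · simp
  · obtain ⟨b, rfl⟩ : ∃ b, a = b + 1 := ⟨a - 1, by omega⟩
    simp

lemma psi_flip : ∀ (l : List ℕ) (s : Bool), psi s (l.map flip) = psi (!s) l
  | [], s => rfl
  | a :: l, s => by
    simp only [psi, List.map_cons, flip_bodd]
    rw [psi_flip l]
    cases s <;> cases a.bodd <;> simp

lemma phi_flip (s : Bool) (l : List ℕ) (h : NC l) : phi s (l.map flip) = phi (!s) l := by
  unfold phi
  rw [← psi_flip]
  congr 1
  apply List.Perm.eq_of_pairwise (le := (· ≤ ·))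
  · intro a b _ _ h1 h2; exact le_antisymm h1 h2
  · exact List.pairwise_insertionSort _ _
  · rw [List.pairwise_map]
    refine List.Pairwise.imp_of_mem ?_ (List.pairwise_insertionSort (· ≤ ·) l)
    intro a b ha hb hab
    have := h a (by simpa using ha) b (by simpa using hb)
    unfold flip
    split_ifs <;> omega
  · exact (List.perm_insertionSort _ _).trans ((List.perm_insertionSort _ l).map flip).symm

lemma psi_pairwise : ∀ (l : List ℕ) (s : Bool), l.Pairwise (· ≤ ·) → NC l → psi s l ≠ 0 →
    l.Pairwise (fun a b => a / 2 < b / 2)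
  | [], _, _, _, _ => List.Pairwise.nil
  | a :: l, s, hs, hn, hp => by
    simp only [psi] at hp
    split_ifs at hp with h
    · rw [List.pairwise_cons] at hs ⊢
      have ih := psi_pairwise l (!s) hs.2
        (fun x hx y hy => hn x (by simp [hx]) y (by simp [hy])) hp
      refine ⟨?_, ih⟩
      cases l with
      | nil => simp
      | cons c l =>
        simp only [psi] at hp
        split_ifs at hp with h2
        · have hac : a ≠ c := by
            rintro rfl
            rw [h] at h2
            cases s <;> simp at h2
          have h3 := hn a (by simp) c (by simp)
          have h4 := hs.1 c (by simp)
          have h5 : a / 2 < c / 2 := by omega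
          intro b hb
          rcases List.mem_cons.1 hb with rfl | hb
          · exact h5
          · have := (List.pairwise_cons.1 ih).1 b hb
            omega
        · simp at hp
    · simp at hp

lemma phi_zero (n : ℕ) (s : Bool) (l : List ℕ) (h : NC l) (hl : ∀ a ∈ l, a < 2 * n)
    (hlen : n < l.length) : phi s l = 0 := by
  by_contra hne
  have h1 := psi_pairwise _ s (List.pairwise_insertionSort (· ≤ ·) l)
    (fun a ha b hb => h a (by simpa using ha) b (by simpa using hb)) hne
  have h2 : ((l.insertionSort (· ≤ ·)).map (· / 2)).Nodup := by
    rw [List.Nodup, List.pairwise_map]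
    exact h1.imp (fun h => ne_of_lt h)
  have h3 : ((l.insertionSort (· ≤ ·)).map (· / 2)) ⊆ List.range n := by
    intro x hx
    simp only [List.mem_map, List.mem_insertionSort] at hx
    obtain ⟨a, ha, rfl⟩ := hx
    have := hl a ha
    simp; omega
  have h4 := (h2.subperm h3).length_le
  simp at h4
  omega

section geom
variable {E : Type*} [NormedAddCommGroup E] [NormedSpace ℝ E]

noncomputable def bary (l : List E) : E := (l.length : ℝ)⁻¹ • l.sum

/-- dual of barycentric subdivision -/
noncomputable def S : ℕ → (List E → ZMod 2) → List E → ZMod 2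
  | 0, f => f
  | k + 1, f => fun l => D l (S k (fun m => f (bary l :: m)))

/-- evaluation of `f` on the `k`-dimensional hemisphere of the cross-polytope -/
def C (e : ℕ → E) : ℕ → (List E → ZMod 2) → ZMod 2
  | 0, f => f [e 0]
  | k + 1, f => C e k (fun l => f (e (k + 1) :: l)) +
      C e k (fun l => f (e (k + 1) :: l.map (fun x => -x)))

lemma S_add : ∀ (k : ℕ) (f g : List E → ZMod 2) (l : List E),
    S k (fun m => f m + g m) l = S k f l + S k g l
  | 0, _, _, _ => rfl
  | k + 1, f, g, l => by
    simp only [S]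
    rw [← D_add]
    congr 1
    funext m
    exact S_add k _ _ m

lemma S_congr_len : ∀ (k : ℕ) (f g : List E → ZMod 2) (l : List E), l.length = k →
    (∀ m : List E, m.length = k → f m = g m) → S k f l = S k g l
  | 0, f, g, l, hl, h => h l hl
  | k + 1, f, g, l, hl, h => by
    simp only [S]
    apply D_congr
    intro m _ hm
    exact S_congr_len k _ _ m (by omega) (fun m' hm' => h _ (by simp [hm']))

lemma S_D : ∀ (k : ℕ) (f : List E → ZMod 2) (l : List E), l.length = k + 1 →
    S (k + 1) (fun m => D m f) l = D l (S k f)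
  | k, f, l, hl => by
    have h0 : S (k + 1) (fun m => D m f) l =
        D l (S k f) + D l (S k (fun m => D m (fun m' => f (bary l :: m')))) := by
      rw [← D_add]
      simp only [S, D]
      congr 1
      funext m
      exact S_add k _ _ m
    rw [h0]
    cases k with
    | zero =>
      obtain ⟨a, rfl⟩ := List.length_eq_one_iff.1 hl
      simp [S, D]
    | succ k =>
      rw [D_congr l (S (k + 1) (fun m => D m (fun m' => f (bary l :: m'))))
        (fun m => D m (S k (fun m' => f (bary l :: m')))), D_D, add_zero]
      intro m _ hm
      exact S_D k _ m (by omega)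

lemma Sit_D (k : ℕ) (f : List E → ZMod 2) (N : ℕ) : ∀ (l : List E), l.length = k + 1 →
    ((S (k + 1))^[N] (fun m => D m f)) l = D l ((S k)^[N] f) := by
  induction N with
  | zero => intro l _; rfl
  | succ N ih =>
    intro l hl
    rw [Function.iterate_succ_apply', Function.iterate_succ_apply']
    rw [S_congr_len (k + 1) _ _ l hl ih]
    exact S_D k _ l hl

lemma bary_neg (l : List E) : bary (l.map (fun x => -x)) = - bary l := by
  have : ∀ l : List E, (l.map (fun x => -x)).sum = - l.sum := by
    intro l
    induction l with
    | nil => simp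
    | cons a l ih => simp [ih]; abel
  simp [bary, this]

lemma S_neg : ∀ (k : ℕ) (f : List E → ZMod 2) (l : List E),
    S k f (l.map (fun x => -x)) = S k (fun m => f (m.map (fun x => -x))) l
  | 0, _, _ => rfl
  | k + 1, f, l => by
    simp only [S]
    rw [D_map, bary_neg]
    congr 1
    funext m
    rw [S_neg k]
    rfl

lemma Sit_neg (k N : ℕ) (f : List E → ZMod 2) (l : List E) :
    ((S k)^[N] f) (l.map (fun x => -x)) = ((S k)^[N] (fun m => f (m.map (fun x => -x)))) l := by
  induction N generalizing f with
  | zero => rfl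
  | succ N ih =>
    rw [Function.iterate_succ_apply, Function.iterate_succ_apply, ih]
    have : (fun m : List E => S k f (m.map (fun x => -x))) =
        S k (fun m => f (m.map (fun x => -x))) := by
      funext m
      rw [S_neg]
    rw [this]

lemma Sit_add (k N : ℕ) (f g : List E → ZMod 2) (l : List E) :
    ((S k)^[N] (fun m => f m + g m)) l = ((S k)^[N] f) l + ((S k)^[N] g) l := by
  induction N generalizing f g with
  | zero => rfl
  | succ N ih =>
    simp only [Function.iterate_succ_apply]
    rw [← ih]
    have : S k (fun m => f m + g m) = (fun m => S k f m + S k g m) := by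
      funext m
      rw [S_add]
    rw [this]

lemma C_add (e : ℕ → E) : ∀ (k : ℕ) (f g : List E → ZMod 2),
    C e k (fun m => f m + g m) = C e k f + C e k g
  | 0, _, _ => rfl
  | k + 1, f, g => by
    simp only [C]
    rw [C_add e k, C_add e k]
    ring

lemma C_D (e : ℕ → E) : ∀ (k : ℕ) (f : List E → ZMod 2),
    C e (k + 1) (fun l => D l f) = C e k f + C e k (fun l => f (l.map (fun x => -x)))
  | k, f => by
    have h0 : C e (k + 1) (fun l => D l f) =
      (C e k f + C e k (fun l => f (l.map (fun x => -x)))) +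
      (C e k (fun l => D l (fun m => f (e (k + 1) :: m))) +
       C e k (fun l => D l (fun m => f (e (k + 1) :: m.map (fun x => -x))))) := by
      simp only [C, D, D_map]
      rw [C_add, C_add]
      ring
    rw [h0]
    suffices h : (C e k (fun l => D l (fun m => f (e (k + 1) :: m))) +
       C e k (fun l => D l (fun m => f (e (k + 1) :: m.map (fun x => -x))))) = 0 by
      rw [h, add_zero]
    cases k with
    | zero => simp [C, D]; exact CharTwo.add_self_eq_zero _
    | succ k =>
      rw [C_D e k, C_D e k]
      simp only [List.map_map]
      have : ((fun x : E => -x) ∘ fun x => -x) = id := by funext x; simp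
      simp only [this, List.map_id]
      rw [add_comm (C e k fun m => f (e (k + 1 + 1) :: m))]
      exact CharTwo.add_self_eq_zero _

/-- the ordered simplices of the cross-polytope used by `C e k` -/
def Base (e : ℕ → E) (k : ℕ) (l : List E) : Prop :=
  l.length = k + 1 ∧ ∃ σ : ℕ → ℝ, (∀ i, σ i = 1 ∨ σ i = -1) ∧ ∀ v ∈ l, ∃ i ≤ k, v = σ i • e i

lemma Base.neg {e : ℕ → E} {k : ℕ} {l : List E} (h : Base e k l) :
    Base e k (l.map (fun x => -x)) := by
  obtain ⟨h1, σ, h2, h3⟩ := h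
  refine ⟨by simpa using h1, fun i => - σ i, fun i => ?_, ?_⟩
  · rcases h2 i with h | h <;> simp [h]
  · intro v hv
    obtain ⟨w, hw, rfl⟩ := List.mem_map.1 hv
    obtain ⟨i, hi, rfl⟩ := h3 w hw
    exact ⟨i, hi, by simp⟩

lemma Base.cons {e : ℕ → E} {k : ℕ} {l : List E} (h : Base e k l) :
    Base e (k + 1) (e (k + 1) :: l) := by
  obtain ⟨h1, σ, h2, h3⟩ := h
  refine ⟨by simpa using h1, Function.update σ (k + 1) 1, fun i => ?_, ?_⟩
  · by_cases hi : i = k + 1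
    · subst hi; simp
    · simpa [hi] using h2 i
  · intro v hv
    rcases List.mem_cons.1 hv with rfl | hv
    · exact ⟨k + 1, le_rfl, by simp⟩
    · obtain ⟨i, hi, rfl⟩ := h3 v hv
      refine ⟨i, by omega, ?_⟩
      rw [Function.update_of_ne (by omega)]

lemma C_congr (e : ℕ → E) : ∀ (k : ℕ) (f g : List E → ZMod 2),
    (∀ l, Base e k l → f l = g l) → C e k f = C e k g
  | 0, f, g, h => h _ ⟨rfl, fun _ => 1, by simp, by simp⟩
  | k + 1, f, g, h => by
    simp only [C]
    rw [C_congr e k _ _ (fun l hl => h _ hl.cons), C_congr e k _ _ (fun l hl => h _ hl.neg.cons)]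

lemma sum_sub_le (v : E) (d : ℝ) : ∀ (l : List E), (∀ u ∈ l, ‖u - v‖ ≤ d) →
    ‖l.sum - (l.length : ℝ) • v‖ ≤ l.length * d
  | [], _ => by simp
  | a :: l, h => by
    have ih := sum_sub_le v d l (fun u hu => h u (by simp [hu]))
    have ha := h a (by simp)
    have : (a :: l).sum - ((a :: l).length : ℝ) • v = (a - v) + (l.sum - (l.length : ℝ) • v) := by
      simp [add_smul]; abel
    rw [this]
    refine (norm_add_le _ _).trans ?_
    simp only [List.length_cons]
    push_cast
    linarith

lemma bary_dist (n k : ℕ) (hk : k ≤ n) (l : List E) (hl : l.length = k + 1) (d : ℝ) (hd : 0 ≤ d)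
    (h : ∀ u ∈ l, ∀ v ∈ l, ‖u - v‖ ≤ d) (y : E) (hy : y ∈ convexHull ℝ {x | x ∈ l}) :
    ‖y - bary l‖ ≤ (n / (n + 1) : ℝ) * d := by
  have key : {x | x ∈ l} ⊆ Metric.closedBall (bary l) ((n / (n + 1) : ℝ) * d) := by
    intro v hv
    rw [mem_closedBall_iff_norm, norm_sub_rev]
    obtain ⟨s, t, rfl⟩ := List.append_of_mem hv
    have h1 := sum_sub_le v d (s ++ t) (fun u hu => h u (by
      simp only [List.mem_append, List.mem_cons] at hu ⊢; tauto) v hv)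
    have hlen : (s ++ t).length = k := by simp at hl ⊢; omega
    have h2 : bary (s ++ v :: t) - v =
        ((k : ℝ) + 1)⁻¹ • ((s ++ t).sum - ((s ++ t).length : ℝ) • v) := by
      have hk1 : ((k : ℝ) + 1) ≠ 0 := by positivity
      have hv' : v = ((k : ℝ) + 1)⁻¹ • (((k : ℝ) + 1) • v) := by
        rw [smul_smul, inv_mul_cancel₀ hk1, one_smul]
      rw [bary, hl, hlen]
      push_cast
      conv_lhs => rw [hv']
      rw [← smul_sub]
      congr 1
      rw [← hv']
      simp [add_smul]; abel
    rw [hlen] at h1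
    rw [h2, norm_smul, hlen]
    rw [Real.norm_of_nonneg (by positivity)]
    calc ((k : ℝ) + 1)⁻¹ * _ ≤ ((k : ℝ) + 1)⁻¹ * (k * d) := by gcongr
      _ = (k / (k + 1) : ℝ) * d := by field_simp
      _ ≤ _ := by
        gcongr ?_ * d
        have : (k : ℝ) ≤ n := by exact_mod_cast hk
        rw [div_le_div_iff₀ (by positivity) (by positivity)]
        nlinarith
  have := convexHull_min key (convex_closedBall _ _) hy
  rwa [mem_closedBall_iff_norm] at this

lemma bary_mem (l : List E) (hl : l ≠ []) : bary l ∈ convexHull ℝ {x | x ∈ l} := by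
  have hpos : 0 < l.length := List.length_pos_iff.2 hl
  have : bary l = ∑ i : Fin l.length, (l.length : ℝ)⁻¹ • l.get i := by
    rw [← Finset.smul_sum, bary]
    congr 1
    simp [Fin.sum_univ_getElem]
  rw [this]
  apply (convex_convexHull ℝ _).sum_mem
  · intros; positivity
  · simp; field_simp
  · intro i _
    exact subset_convexHull ℝ _ (List.get_mem l i)

lemma S_local (n : ℕ) (d : ℝ) (hd : 0 ≤ d) : ∀ (k : ℕ), k ≤ n + 1 →
    ∀ (f g : List E → ZMod 2) (l : List E), l.length = k →
    (∀ u ∈ l, ∀ v ∈ l, ‖u - v‖ ≤ d) →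
    (∀ m : List E, m.length = k → (∀ v ∈ m, v ∈ convexHull ℝ {x | x ∈ l}) →
      (∀ u ∈ m, ∀ v ∈ m, ‖u - v‖ ≤ (n / (n + 1) : ℝ) * d) → f m = g m) → S k f l = S k g l
  | 0, _, f, g, l, hl, _, h => by
    obtain rfl := List.length_eq_zero_iff.1 hl
    exact h [] rfl (by simp) (by simp)
  | k + 1, hk, f, g, l, hl, hp, h => by
    simp only [S]
    apply D_congr
    intro m hm hml
    have hsub : convexHull ℝ {x | x ∈ m} ⊆ convexHull ℝ {x | x ∈ l} :=
      convexHull_mono (fun x hx => hm.subset hx)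
    apply S_local n d hd k (by omega) _ _ m (by omega)
      (fun u hu v hv => hp u (hm.subset hu) v (hm.subset hv))
    intro m' hm' hm'h hm'p
    have hb := bary_dist n k (by omega) l hl d hd hp
    apply h _ (by simp [hm'])
    · intro v hv
      rcases List.mem_cons.1 hv with rfl | hv
      · exact bary_mem l (by rintro rfl; simp at hl)
      · exact hsub (hm'h v hv)
    · intro u hu v hv
      rcases List.mem_cons.1 hu with rfl | hu <;> rcases List.mem_cons.1 hv with rfl | hv
      · simp; positivity
      · rw [norm_sub_rev]; exact hb v (hsub (hm'h v hv))
      · exact hb u (hsub (hm'h u hu))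
      · exact hm'p u hu v hv

lemma Sit_local (n : ℕ) (d : ℝ) (hd : 0 ≤ d) (k : ℕ) (hk : k ≤ n + 1) (N : ℕ)
    (f g : List E → ZMod 2) (l : List E) (hl : l.length = k)
    (hp : ∀ u ∈ l, ∀ v ∈ l, ‖u - v‖ ≤ d)
    (h : ∀ m : List E, m.length = k → (∀ v ∈ m, v ∈ convexHull ℝ {x | x ∈ l}) →
      (∀ u ∈ m, ∀ v ∈ m, ‖u - v‖ ≤ (n / (n + 1) : ℝ) ^ N * d) → f m = g m) :
    ((S k)^[N] f) l = ((S k)^[N] g) l := by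
  induction N generalizing f g with
  | zero => exact h l hl (fun v hv => subset_convexHull ℝ _ hv) (by simpa using hp)
  | succ N ih =>
    rw [Function.iterate_succ_apply, Function.iterate_succ_apply]
    apply ih
    intro m hm hmh hmp
    apply S_local n ((n / (n + 1) : ℝ) ^ N * d) (by positivity) k hk _ _ m hm hmp
    intro m' hm' hm'h hm'p
    apply h m' hm'
    · intro v hv
      exact convexHull_min hmh (convex_convexHull ℝ _) (hm'h v hv)
    · intro u hu v hv
      have := hm'p u hu v hv
      rwa [← mul_assoc, ← pow_succ'] at this

lemma Sit_one (N : ℕ) (f : List E → ZMod 2) (v : E) : ((S 1)^[N] f) [v] = f [v] := by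
  induction N generalizing f with
  | zero => rfl
  | succ N ih =>
    rw [Function.iterate_succ_apply, ih]
    simp [S, D, bary]

/-- Abstract Tucker lemma. -/
theorem tucker (n N : ℕ) (e : ℕ → E) (X : Set E) (d δ : ℝ) (hd : 0 ≤ d)
    (hδ : (n / (n + 1) : ℝ) ^ N * d ≤ δ)
    (hX : ∀ k ≤ n, ∀ l, Base e k l → convexHull ℝ {x | x ∈ l} ⊆ X)
    (hdiam : ∀ k ≤ n, ∀ l, Base e k l → ∀ u ∈ l, ∀ v ∈ l, ‖u - v‖ ≤ d)
    (lam : E → ℕ) (hlt : ∀ x ∈ X, lam x < 2 * n)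
    (hodd : ∀ x ∈ X, lam (-x) = flip (lam x))
    (hnc : ∀ x ∈ X, ∀ y ∈ X, ‖x - y‖ ≤ δ → lam x / 2 = lam y / 2 → lam x = lam y) : False := by
  set F : List E → ZMod 2 := fun l => phi true (l.map lam) with hF
  let a : ℕ → ZMod 2 := fun k => C e k ((S (k + 1))^[N] (fun m => F m + F (m.map (fun x => -x))))
  have hNC : ∀ m : List E, (∀ v ∈ m, v ∈ X) → (∀ u ∈ m, ∀ v ∈ m, ‖u - v‖ ≤ δ) →
      NC (m.map lam) := by
    intro m h1 h2 x hx y hy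
    obtain ⟨u, hu, rfl⟩ := List.mem_map.1 hx
    obtain ⟨v, hv, rfl⟩ := List.mem_map.1 hy
    exact hnc u (h1 u hu) v (h1 v hv) (h2 u hu v hv)
  have hA : ∀ m : List E, (∀ v ∈ m, v ∈ X) → (∀ u ∈ m, ∀ v ∈ m, ‖u - v‖ ≤ δ) →
      F (m.map (fun x => -x)) = phi false (m.map lam) := by
    intro m h1 h2
    have : (m.map (fun x => -x)).map lam = (m.map lam).map flip := by
      rw [List.map_map, List.map_map]
      apply List.map_congr_left
      intro x hx
      exact hodd x (h1 x hx)
    simp only [hF]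
    rw [this, phi_flip _ _ (hNC m h1 h2)]
    rfl
  have hstep : ∀ k, k + 1 ≤ n → a (k + 1) = a k := by
    intro k hk
    have h1 : a (k + 1) = C e (k + 1) ((S (k + 1 + 1))^[N] (fun m => D m F)) := by
      apply C_congr
      intro l hl
      apply Sit_local n d hd _ (by omega) N _ _ l hl.1 (hdiam _ hk l hl)
      intro m _ hm2 hm3
      have hm2' : ∀ v ∈ m, v ∈ X := fun v hv => hX _ hk l hl (hm2 v hv)
      have hm3' : ∀ u ∈ m, ∀ v ∈ m, ‖u - v‖ ≤ δ := fun u hu v hv => (hm3 u hu v hv).trans hδ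
      rw [hA m hm2' hm3', hF, ← D_map, D_phi]
      rfl
    rw [h1, C_congr e (k + 1) _ (fun l => D l ((S (k + 1))^[N] F)) (fun l hl => Sit_D _ _ _ l hl.1),
      C_D, ← C_add]
    apply C_congr
    intro l _
    rw [Sit_neg, Sit_add]
  have h0 : ∀ k ≤ n, a k = 1 := by
    intro k
    induction k with
    | zero =>
      intro _
      have hB : Base e 0 [e 0] := ⟨rfl, fun _ => 1, by simp, by simp⟩
      have he : e 0 ∈ X := hX 0 (by omega) _ hB (subset_convexHull ℝ _ (by simp))
      have hδ0 : 0 ≤ δ := le_trans (by positivity) hδ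
      simp only [a, C]
      rw [Sit_one, hA [e 0] (by simpa using he) (by simpa using hδ0)]
      have hs : ∀ c : ℕ, [c].insertionSort (· ≤ ·) = [c] := fun c => rfl
      simp only [hF, phi, List.map_cons, List.map_nil, hs, psi]
      cases (lam (e 0)).bodd <;> simp
    | succ k ih =>
      intro hk
      rw [hstep k hk, ih (by omega)]
  have hn : a n = 0 := by
    have : a n = C e n ((S (n + 1))^[N] (fun m => (0 : ZMod 2))) := by
      apply C_congr
      intro l hl
      apply Sit_local n d hd _ (by omega) N _ _ l hl.1 (hdiam _ le_rfl l hl)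
      intro m hm1 hm2 hm3
      have hm2' : ∀ v ∈ m, v ∈ X := fun v hv => hX _ le_rfl l hl (hm2 v hv)
      have hm3' : ∀ u ∈ m, ∀ v ∈ m, ‖u - v‖ ≤ δ := fun u hu v hv => (hm3 u hu v hv).trans hδ
      have hlt' : ∀ x ∈ m.map lam, x < 2 * n := by
        intro x hx
        obtain ⟨u, hu, rfl⟩ := List.mem_map.1 hx
        exact hlt u (hm2' u hu)
      rw [hA m hm2' hm3', hF]
      simp only
      rw [phi_zero n _ _ (hNC m hm2' hm3') hlt' (by simp; omega),
        phi_zero n _ _ (hNC m hm2' hm3') hlt' (by simp; omega), add_zero]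
    rw [this]
    have h1 := Sit_add (E := E) (n + 1) N (fun _ => 0) (fun _ => 0)
    have h2 := C_add e n ((S (n + 1))^[N] (fun m => (0 : ZMod 2)))
      ((S (n + 1))^[N] (fun m => (0 : ZMod 2)))
    simp only [← h1, add_zero] at h2
    simpa using h2
  rw [h0 n le_rfl] at hn
  exact one_ne_zero hn

end geom
end CH
namespace CH

/-- Approximate Borsuk-Ulam on the cross-polytope. -/
theorem borsuk (n : ℕ) (F : Fin n → (Fin (n + 1) → ℝ) → ℝ) (hc : ∀ i, Continuous (F i))
    (hodd : ∀ i x, F i (-x) = - F i x) (ε : ℝ) (hε : 0 < ε) :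
    ∃ x : Fin (n + 1) → ℝ, ∑ i, |x i| = 1 ∧ ∀ i, |F i x| ≤ ε := by
  by_contra! hcon
  let X : Set (Fin (n + 1) → ℝ) := {x | ∑ i, |x i| = 1}
  let e : ℕ → (Fin (n + 1) → ℝ) := fun k i => if i.val = k then 1 else 0
  have hXc : IsCompact X := by
    apply Metric.isCompact_of_isClosed_isBounded
    · exact isClosed_eq (by fun_prop) continuous_const
    · rw [isBounded_iff_forall_norm_le]
      refine ⟨1, fun x hx => ?_⟩
      rw [pi_norm_le_iff_of_nonneg zero_le_one]
      intro i
      rw [Real.norm_eq_abs, ← (show ∑ i, |x i| = 1 from hx)]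
      exact Finset.single_le_sum (f := fun i => |x i|) (fun _ _ => abs_nonneg _)
        (Finset.mem_univ i)
  have hG : Continuous (fun x => (fun i => F i x)) := continuous_pi hc
  have hU := hXc.uniformContinuousOn_of_continuous hG.continuousOn
  rw [Metric.uniformContinuousOn_iff] at hU
  obtain ⟨δ, hδ, hU⟩ := hU ε hε
  obtain ⟨N, hN⟩ : ∃ N : ℕ, (n / (n + 1) : ℝ) ^ N < δ / 2 / 2 := by
    apply exists_pow_lt_of_lt_one (by positivity)
    rw [div_lt_one (by positivity)]
    linarith
  have hek : ∀ k ≤ n, ∑ i, |e k i| = 1 := by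
    intro k hk
    rw [Finset.sum_eq_single ⟨k, by omega⟩]
    · simp [e]
    · intro b _ hb
      have : b.val ≠ k := fun h => hb (Fin.ext h)
      simp [e, this]
    · simp
  obtain ⟨i0, _⟩ := hcon (e 0) (hek 0 (by omega))
  have : Nonempty (Fin n) := ⟨i0⟩
  let idx : (Fin (n + 1) → ℝ) → Fin n := fun x => Classical.epsilon (fun i => ε < |F i x|)
  have hidx : ∀ x ∈ X, ε < |F (idx x) x| := fun x hx => Classical.epsilon_spec (hcon x hx)
  have hidxn : ∀ x, idx (-x) = idx x := by
    intro x
    simp only [idx, hodd, abs_neg]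
  let lam : (Fin (n + 1) → ℝ) → ℕ := fun x => 2 * (idx x).val + if 0 < F (idx x) x then 0 else 1
  refine tucker n N e X 2 (δ / 2) (by norm_num) (by linarith) ?_ ?_ lam ?_ ?_ ?_
  · intro k hk l ⟨_, σ, hσ, hl⟩
    have hs : convexHull ℝ {x | x ∈ l} ⊆
        {x : Fin (n + 1) → ℝ | (∀ i : Fin (n + 1), 0 ≤ σ i * x i) ∧
          ∑ i : Fin (n + 1), σ i * x i = 1} := by
      apply convexHull_min
      · intro v hv
        obtain ⟨j, hj, rfl⟩ := hl v hv
        have hjj : σ j * σ j = 1 := by rcases hσ j with h | h <;> rw [h] <;> norm_num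
        constructor
        · intro i
          by_cases h : i.val = j
          · simp [e, h, hjj]
          · simp [e, h]
        · rw [Finset.sum_eq_single ⟨j, by omega⟩]
          · simp [e, hjj]
          · intro b _ hb
            have : b.val ≠ j := fun h => hb (Fin.ext h)
            simp [e, this]
          · simp
      · intro x hx y hy a b ha hb hab
        constructor
        · intro i
          have h1 := mul_nonneg ha (hx.1 i)
          have h2 := mul_nonneg hb (hy.1 i)
          simp only [Pi.add_apply, Pi.smul_apply, smul_eq_mul]
          linarith
        · have : ∑ i : Fin (n + 1), σ i * (a • x + b • y) i =
              a * ∑ i : Fin (n + 1), σ i * x i + b * ∑ i : Fin (n + 1), σ i * y i := by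
            rw [Finset.mul_sum, Finset.mul_sum, ← Finset.sum_add_distrib]
            refine Finset.sum_congr rfl fun i _ => ?_
            simp only [Pi.add_apply, Pi.smul_apply, smul_eq_mul]
            ring
          rw [this, hx.2, hy.2]
          linarith
    intro x hx
    obtain ⟨h1, h2⟩ := hs hx
    show ∑ i, |x i| = 1
    rw [← h2]
    refine Finset.sum_congr rfl fun i _ => ?_
    have := h1 i
    rw [← abs_of_nonneg this, abs_mul]
    rcases hσ i with h | h <;> simp [h]
  · intro k hk l ⟨_, σ, hσ, hl⟩
    have : ∀ u ∈ l, ‖u‖ ≤ 1 := by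
      intro u hu
      obtain ⟨j, hj, rfl⟩ := hl u hu
      rw [pi_norm_le_iff_of_nonneg zero_le_one]
      intro i
      rcases hσ j with h | h <;> by_cases h' : i.val = j <;> simp [e, h, h']
    intro u hu v hv
    have := norm_sub_le u v
    have := this.trans (add_le_add (‹∀ u ∈ l, ‖u‖ ≤ 1› u hu) (‹∀ u ∈ l, ‖u‖ ≤ 1› v hv))
    linarith
  · intro x _
    have := (idx x).isLt
    simp only [lam]
    split_ifs <;> omega
  · intro x hx
    have h := hidx x hx
    simp only [lam, hidxn, hodd, flip]
    rcases lt_abs.1 h with h | h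
    · have h1 : 0 < F (idx x) x := by linarith
      have h2 : ¬ 0 < - F (idx x) x := by linarith
      simp only [h1, h2, if_true, if_false]
      split_ifs <;> omega
    · have h1 : ¬ 0 < F (idx x) x := by linarith
      have h2 : 0 < - F (idx x) x := by linarith
      simp only [h1, h2, if_true, if_false]
      split_ifs <;> omega
  · intro x hx y hy hxy h
    have hi : idx x = idx y := by
      apply Fin.ext
      simp only [lam] at h
      split_ifs at h <;> omega
    have h1 := hidx x hx
    have h2 := hidx y hy
    have h3 := hU x hx y hy (by rw [dist_eq_norm]; linarith)
    have h4 := (dist_le_pi_dist _ _ (idx x)).trans_lt h3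
    rw [Real.dist_eq] at h4
    simp only [lam]
    rw [← hi] at h2 ⊢
    congr 1
    have h5 := abs_lt.1 h4
    rcases lt_abs.1 h1 with h1 | h1 <;> rcases lt_abs.1 h2 with h2 | h2
    · rw [if_pos (by linarith), if_pos (by linarith)]
    · linarith
    · linarith
    · rw [if_neg (by linarith), if_neg (by linarith)]

noncomputable def hh (G : ℝ → ℝ) (t a : ℝ) : ℝ :=
  if 0 ≤ a then G (t + a) - G t else -(G (t - a) - G t)

lemma hh_cont (G : ℝ → ℝ) (hG : Continuous G) : Continuous (fun p : ℝ × ℝ => hh G p.1 p.2) := by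
  unfold hh
  apply Continuous.if_le
  · fun_prop
  · fun_prop
  · fun_prop
  · fun_prop
  · intro p hp
    simp [← hp]

lemma hh_neg (G : ℝ → ℝ) (t a : ℝ) : hh G t (-a) = - hh G t a := by
  unfold hh
  rcases lt_trichotomy a 0 with h | h | h
  · rw [if_pos (by linarith), if_neg (by linarith)]
    simp [sub_eq_add_neg]
  · simp [h]
  · rw [if_neg (by linarith), if_pos (by linarith)]
    simp [sub_eq_add_neg]

noncomputable def T {n : ℕ} (x : Fin (n + 1) → ℝ) (k : ℕ) : ℝ :=
  ∑ j : Fin (n + 1), if j.val < k then |x j| else 0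

lemma T_succ {n : ℕ} (x : Fin (n + 1) → ℝ) (k : Fin (n + 1)) :
    T x (k.val + 1) = T x k.val + |x k| := by
  have : |x k| = ∑ j : Fin (n + 1), if j = k then |x j| else 0 := by simp
  rw [this, T, T, ← Finset.sum_add_distrib]
  refine Finset.sum_congr rfl fun j _ => ?_
  have hjk : j = k ↔ j.val = k.val := Fin.ext_iff
  simp only [hjk]
  split_ifs <;> first | omega | simp

lemma T_mono {n : ℕ} (x : Fin (n + 1) → ℝ) : Monotone (T x) := by
  intro a b hab
  apply Finset.sum_le_sum
  intro j _
  have := abs_nonneg (x j)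
  split_ifs <;> first | omega | simp [this]

lemma G_sub (μ : Measure ℝ) [IsProbabilityMeasure μ] (a b : ℝ) (h : a ≤ b) :
    (μ (Set.Iic b)).toReal - (μ (Set.Iic a)).toReal = (μ (Set.Ioc a b)).toReal := by
  have := measureReal_union (μ := μ) (s₁ := Set.Iic a) (s₂ := Set.Ioc a b)
    (Set.Iic_disjoint_Ioc le_rfl) measurableSet_Ioc
  rw [Set.Iic_union_Ioc_eq_Iic h] at this
  simp only [Measure.real] at this
  linarith

lemma G_cont (μ : Measure ℝ) [IsProbabilityMeasure μ] (M : ℝ) (hM : 0 < M)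
    (hd : ∀ s : Set ℝ, MeasurableSet s → μ s ≤ ENNReal.ofReal M * volume s) :
    Continuous (fun t => (μ (Set.Iic t)).toReal) := by
  refine (LipschitzWith.of_le_add_mul M.toNNReal fun x y => ?_).continuous
  rw [Real.coe_toNNReal _ hM.le]
  rcases le_total x y with h | h
  · have := G_sub μ x y h
    have h1 : 0 ≤ (μ (Set.Ioc x y)).toReal := ENNReal.toReal_nonneg
    have : 0 ≤ M * dist x y := by positivity
    linarith
  · have h0 := G_sub μ y x h
    have h1 := hd _ (measurableSet_Ioc (a := y) (b := x))
    rw [Real.volume_Ioc, ← ENNReal.ofReal_mul hM.le] at h1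
    have h2 := ENNReal.toReal_le_of_le_ofReal (mul_nonneg hM.le (by linarith)) h1
    rw [Real.dist_eq, abs_of_nonneg (by linarith)]
    linarith

end CH

/-- **Existence of an ε-approximate consensus halving with `n` cuts.** For `n` agents
with valuations given by probability measures on `[0,1]`, absolutely continuous with
densities bounded by `M`, and any `ε > 0`, there are cut points `0 = t₀ ≤ … ≤ t_{n+1} = 1`
and a `±`-labeling of the `n+1` intervals so that every agent's values for the two
portions differ by at most `ε`. -/
theorem approx_consensus_halving_exists (n : ℕ) (μ : Fin n → Measure ℝ)
    [∀ i, IsProbabilityMeasure (μ i)]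
    (M : ℝ) (hM : 0 < M)
    (hdensity : ∀ i, ∀ s : Set ℝ, MeasurableSet s →
      μ i s ≤ ENNReal.ofReal M * volume s)
    (ε : ℝ) (hε : 0 < ε) :
    ∃ (t : Fin (n + 2) → ℝ) (label : Fin (n + 1) → Bool),
      Monotone t ∧ t 0 = 0 ∧ t (Fin.last (n + 1)) = 1 ∧
      ∀ i,
        |(μ i (⋃ k : Fin (n + 1),
            if label k then Set.Icc (t k.castSucc) (t k.succ) else ∅)).toReal -
         (μ i (⋃ k : Fin (n + 1),
            if label k then ∅ else Set.Icc (t k.castSucc) (t k.succ))).toReal| ≤ ε := by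
  let G : Fin n → ℝ → ℝ := fun i t => (μ i (Set.Iic t)).toReal
  have hG : ∀ i, Continuous (G i) := fun i => CH.G_cont (μ i) M hM (hdensity i)
  obtain ⟨x, hx, hF⟩ := CH.borsuk n (fun i x => ∑ k : Fin (n + 1), CH.hh (G i) (CH.T x k.val) (x k))
    (by
      intro i
      refine continuous_finsetSum _ fun k _ => ?_
      have hT : Continuous (fun x : Fin (n + 1) → ℝ => CH.T x k.val) := by
        unfold CH.T
        refine continuous_finsetSum _ fun j _ => ?_
        split_ifs <;> fun_prop
      exact (CH.hh_cont (G i) (hG i)).comp (hT.prodMk (continuous_apply k)))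
    (by
      intro i x
      rw [← Finset.sum_neg_distrib]
      refine Finset.sum_congr rfl fun k _ => ?_
      rw [Pi.neg_apply, CH.hh_neg]
      simp [CH.T]) ε hε
  have hnull : ∀ i (a : ℝ), μ i {a} = 0 := by
    intro i a
    have := hdensity i {a} (measurableSet_singleton a)
    simpa using this
  have hIcc : ∀ i (a b : ℝ), a ≤ b → (μ i (Set.Icc a b)).toReal = G i b - G i a := by
    intro i a b hab
    have : NullSingletonClass (μ i) := ⟨hnull i⟩
    simp only [G]
    rw [CH.G_sub (μ i) a b hab, measure_congr Ioc_ae_eq_Icc]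
  have hmono : Monotone (fun k : Fin (n + 2) => CH.T x k.val) := fun a b h => CH.T_mono x h
  refine ⟨fun k => CH.T x k.val, fun k => decide (0 ≤ x k), hmono, ?_, ?_, ?_⟩
  · simp [CH.T]
  · simp only [CH.T, Fin.val_last]
    rw [← hx]
    refine Finset.sum_congr rfl fun j _ => ?_
    rw [if_pos j.isLt]
  · intro i
    have hU : ∀ p : Fin (n + 1) → Prop, [DecidablePred p] →
        (μ i (⋃ k : Fin (n + 1), if p k then
          Set.Icc (CH.T x k.castSucc.val) (CH.T x k.succ.val) else ∅)).toReal =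
        ∑ k : Fin (n + 1), if p k then (G i (CH.T x (k.val + 1)) - G i (CH.T x k.val)) else 0 := by
      intro p _
      rw [measure_iUnion₀, tsum_fintype, ENNReal.toReal_sum]
      · refine Finset.sum_congr rfl fun k _ => ?_
        split_ifs with h
        · rw [hIcc i _ _ (CH.T_mono x (by simp))]
          simp
        · simp
      · intro k _
        exact measure_ne_top _ _
      · have key : ∀ a b : Fin (n + 1), a < b → AEDisjoint (μ i)
            (if p a then Set.Icc (CH.T x a.castSucc.val) (CH.T x a.succ.val) else ∅)
            (if p b then Set.Icc (CH.T x b.castSucc.val) (CH.T x b.succ.val) else ∅) := by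
          intro a b hab
          refine measure_mono_null ?_ (hnull i (CH.T x a.succ.val))
          intro y hy
          split_ifs at hy
          · have h1 : CH.T x a.succ.val ≤ CH.T x b.castSucc.val := by
              apply CH.T_mono
              have : a.val < b.val := hab
              simp; omega
            exact le_antisymm hy.1.2 (h1.trans hy.2.1)
          all_goals simp at hy
        intro a b hab
        rcases lt_or_gt_of_ne hab with h | h
        · exact key a b h
        · exact (key b a h).symm
      · intro k
        split_ifs
        · exact measurableSet_Icc.nullMeasurableSet
        · exact MeasurableSet.empty.nullMeasurableSet
    have h1 := hU (fun k => 0 ≤ x k)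
    have h2 := hU (fun k => ¬ 0 ≤ x k)
    simp only [ite_not] at h2
    simp only [decide_eq_true_eq]
    rw [h1, h2, ← Finset.sum_sub_distrib]
    convert hF i using 2
    refine Finset.sum_congr rfl fun k _ => ?_
    rw [CH.T_succ, CH.hh]
    split_ifs with h
    · rw [abs_of_nonneg h]; ring
    · rw [abs_of_neg (by linarith), sub_eq_add_neg (CH.T x k.val)]; ring
end

section
/- Let T be a centrally symmetric triangulation of C^n (the boundary of the (n+1)-dimensional cross-polytope) and let λ be a labeling of the vertices of T with labels in {±1, ±2, ..., ±n} satisfying λ(-x) = -λ(x) for every vertex x. Then there exists an edge of T whose two endpoints have labels summing to zero. -/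
/-- A centrally symmetric triangulation of the boundary
`C^n = {x ∈ ℝ^{n+1} : Σ|xᵢ| = 1}` of the `(n+1)`-dimensional cross-polytope:
a finite collection of `n`-simplices (given by their vertex sets, `n+1` vertices each,
all lying on `C^n`) whose convex hulls cover `C^n`, such that any two simplices meet in
the convex hull of their common vertices (a common face, possibly empty), and such that
the collection is invariant under the antipodal map. -/
structure SymmetricTriangulation (n : ℕ) where
  simplices : Finset (Finset (Fin (n + 1) → ℝ))
  card_eq : ∀ σ ∈ simplices, σ.card = n + 1
  vertices_on_sphere : ∀ σ ∈ simplices, ∀ v ∈ σ, ∑ i, |v i| = 1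
  covers : (⋃ σ ∈ simplices, convexHull ℝ (σ : Set (Fin (n + 1) → ℝ))) =
      {x : Fin (n + 1) → ℝ | ∑ i, |x i| = 1}
  face_inter : ∀ σ ∈ simplices, ∀ η ∈ simplices,
      convexHull ℝ (σ : Set (Fin (n + 1) → ℝ)) ∩ convexHull ℝ (η : Set (Fin (n + 1) → ℝ)) =
        convexHull ℝ ((σ ∩ η : Finset (Fin (n + 1) → ℝ)) : Set (Fin (n + 1) → ℝ))
  symmetric : ∀ σ ∈ simplices, σ.image (fun v => -v) ∈ simplices


namespace TuckerAux

open Finset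

/-- Mod-2 indicator that the labels of `X` are, sorted by absolute value, all of absolute value at
most `k`, strictly increasing in absolute value, alternating, with top sign `s`. -/
def alt {α : Type*} [DecidableEq α] (lab : α → ℤ) : ℕ → ℤ → Finset α → ZMod 2
  | 0, _, X => if X = ∅ then 1 else 0
  | k + 1, s, X => alt lab k s X +
      ∑ v ∈ X with lab v = s * (k + 1), alt lab k (-s) (X.erase v)

lemma alt_empty {α : Type*} [DecidableEq α] (lab : α → ℤ) (k : ℕ) (s : ℤ) :
    alt lab k s ∅ = 1 := by
  induction k generalizing s with
  | zero => simp [alt]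
  | succ k ih => simp [alt, ih]

lemma alt_card {α : Type*} [DecidableEq α] (lab : α → ℤ) (k : ℕ) (s : ℤ) (X : Finset α)
    (h : k < X.card) : alt lab k s X = 0 := by
  induction k generalizing s X with
  | zero =>
    have : X ≠ ∅ := by rintro rfl; simp at h
    simp [alt, this]
  | succ k ih =>
    rw [alt, ih _ _ (by omega), zero_add]
    apply Finset.sum_eq_zero
    intro v hv
    apply ih
    rw [Finset.card_erase_of_mem (Finset.mem_filter.1 hv).1]
    omega

lemma alt_neg {α : Type*} [DecidableEq α] [InvolutiveNeg α] (lab : α → ℤ) (k : ℕ) (s : ℤ)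
    (X : Finset α) (h : ∀ v ∈ X, lab (-v) = - lab v) :
    alt lab k s (X.image (fun v => -v)) = alt lab k (-s) X := by
  induction k generalizing s X with
  | zero => simp [alt]
  | succ k ih =>
    rw [alt, alt, ih _ _ h, Finset.sum_filter, Finset.sum_image (by intro a _ b _; simp),
      Finset.sum_filter]
    congr 1
    apply Finset.sum_congr rfl
    intro v hv
    have h1 : (lab (-v) = s * (k + 1)) ↔ (lab v = -s * (k + 1)) := by
      rw [h v hv]; constructor <;> intro h <;> linarith
    have h2 : (X.image (fun v => -v)).erase (-v) = (X.erase v).image (fun v => -v) := by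
      rw [Finset.image_erase neg_injective]
    simp only [h1, h2]
    rw [ih _ _ (fun u hu => h u (Finset.mem_of_mem_erase hu))]

lemma pair_sum_zero {α : Type*} [DecidableEq α] (Y : Finset α) (F : α → α → ZMod 2)
    (hF : ∀ u v, F u v = F v u) : ∑ u ∈ Y, ∑ v ∈ Y.erase u, F u v = 0 := by
  induction Y using Finset.induction_on with
  | empty => simp
  | insert a Y ha ih =>
    rw [Finset.sum_insert ha, Finset.erase_insert ha]
    have : ∑ u ∈ Y, ∑ v ∈ (insert a Y).erase u, F u v
        = ∑ u ∈ Y, (F u a + ∑ v ∈ Y.erase u, F u v) := by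
      apply Finset.sum_congr rfl
      intro u hu
      have hne : a ≠ u := by rintro rfl; exact ha hu
      rw [Finset.erase_insert_of_ne hne, Finset.sum_insert (by simp [ha])]
    rw [this, Finset.sum_add_distrib, ih, add_zero]
    rw [Finset.sum_congr rfl (fun v _ => hF a v)]
    exact CharTwo.add_self_eq_zero _

lemma abs_split {k : ℕ} {s l : ℤ} (hs : s = 1 ∨ s = -1) :
    (|l| ≤ (k : ℤ) + 1) ↔ (|l| ≤ (k : ℤ) ∨ l = s * (k + 1) ∨ l = -s * (k + 1)) := by
  rcases hs with rfl | rfl <;> rcases abs_cases l with ⟨h, _⟩ | ⟨h, _⟩ <;> rw [h] <;> omega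

lemma sum_split {α : Type*} [DecidableEq α] (lab : α → ℤ) (k : ℕ) (s : ℤ)
    (hs : s = 1 ∨ s = -1) (X : Finset α) (G : α → ZMod 2) :
    ∑ v ∈ X with |lab v| ≤ (k : ℤ) + 1, G v =
      ∑ v ∈ X with |lab v| ≤ (k : ℤ), G v + (∑ v ∈ X with lab v = s * (k + 1), G v
       + ∑ v ∈ X with lab v = -s * (k + 1), G v) := by
  simp only [Finset.sum_filter, ← Finset.sum_add_distrib]
  apply Finset.sum_congr rfl
  intro v _
  have h1 : lab v = s * (k + 1) → ¬ |lab v| ≤ (k : ℤ) := by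
    rcases hs with rfl | rfl <;> rcases abs_cases (lab v) with ⟨h, _⟩ | ⟨h, _⟩ <;> rw [h] <;> omega
  have h2 : lab v = -s * (k + 1) → ¬ |lab v| ≤ (k : ℤ) := by
    rcases hs with rfl | rfl <;> rcases abs_cases (lab v) with ⟨h, _⟩ | ⟨h, _⟩ <;> rw [h] <;> omega
  have h3 : lab v = s * (k + 1) → ¬ lab v = -s * (k + 1) := by
    rcases hs with rfl | rfl <;> omega
  simp only [abs_split hs]
  by_cases a : |lab v| ≤ (k : ℤ)
  · rw [if_pos (Or.inl a), if_pos a, if_neg (fun h => h1 h a), if_neg (fun h => h2 h a)]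
    simp
  · by_cases b : lab v = s * (k + 1)
    · rw [if_pos (Or.inr (Or.inl b)), if_neg a, if_pos b, if_neg (h3 b)]
      simp
    · by_cases c : lab v = -s * (k + 1)
      · rw [if_pos (Or.inr (Or.inr c)), if_neg a, if_pos c, if_neg b]
        simp
      · rw [if_neg (by tauto), if_neg a, if_neg b, if_neg c]
        simp

/-- The key parity identity. -/
lemma alt_parity {α : Type*} [DecidableEq α] (lab : α → ℤ) (k : ℕ) (s : ℤ)
    (hs : s = 1 ∨ s = -1) (X : Finset α) (h0 : ∀ v ∈ X, lab v ≠ 0)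
    (hc : ∀ u ∈ X, ∀ v ∈ X, lab u + lab v ≠ 0) :
    ∑ v ∈ X with |lab v| ≤ (k : ℤ), alt lab k s (X.erase v)
      = alt lab k s X + alt lab k (-s) X := by
  induction k generalizing s X with
  | zero =>
    have : (X.filter fun v => |lab v| ≤ ((0 : ℕ) : ℤ)) = ∅ := by
      apply Finset.filter_eq_empty_iff.2
      intro v hv h
      have := h0 v hv
      simp at h
      exact this h
    rw [this, Finset.sum_empty]
    exact (CharTwo.add_self_eq_zero _).symm
  | succ k ih =>
    have hns : -s = 1 ∨ -s = -1 := by rcases hs with rfl | rfl <;> simp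
    push_cast
    -- expand
    have e1 : ∑ v ∈ X with |lab v| ≤ (k : ℤ) + 1, alt lab (k + 1) s (X.erase v)
        = ∑ v ∈ X with |lab v| ≤ (k : ℤ) + 1, alt lab k s (X.erase v)
        + ∑ v ∈ X with |lab v| ≤ (k : ℤ) + 1, ∑ u ∈ X.erase v with lab u = s * (k + 1),
            alt lab k (-s) ((X.erase v).erase u) := by
      rw [← Finset.sum_add_distrib]; rfl
    have e2 : ∑ v ∈ X with |lab v| ≤ (k : ℤ) + 1, ∑ u ∈ X.erase v with lab u = s * (k + 1),
            alt lab k (-s) ((X.erase v).erase u)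
        = ∑ u ∈ X with lab u = s * (k + 1), ∑ v ∈ X.erase u with |lab v| ≤ (k : ℤ) + 1,
            alt lab k (-s) ((X.erase u).erase v) := by
      rw [Finset.sum_comm' (t' := X.filter fun u => lab u = s * (k + 1))
        (s' := fun u => (X.erase u).filter fun v => |lab v| ≤ (k : ℤ) + 1)]
      · apply Finset.sum_congr rfl
        intro u _
        apply Finset.sum_congr rfl
        intro v _
        rw [Finset.erase_right_comm]
      · intro v u
        simp only [Finset.mem_filter, Finset.mem_erase]
        constructor
        · rintro ⟨⟨a, b⟩, ⟨c, d⟩, e⟩; exact ⟨⟨⟨Ne.symm c, a⟩, b⟩, d, e⟩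
        · rintro ⟨⟨⟨c, a⟩, b⟩, d, e⟩; exact ⟨⟨a, b⟩, ⟨Ne.symm c, d⟩, e⟩
    have e3 : ∀ u ∈ X.filter (fun u => lab u = s * (k + 1)),
        ∑ v ∈ X.erase u with |lab v| ≤ (k : ℤ) + 1, alt lab k (-s) ((X.erase u).erase v)
        = (alt lab k (-s) (X.erase u) + alt lab k s (X.erase u)) +
          ∑ v ∈ (X.filter (fun u => lab u = s * (k + 1))).erase u,
            alt lab k (-s) ((X.erase u).erase v) := by
      intro u hu
      rw [Finset.mem_filter] at hu
      rw [sum_split lab k s hs, ih (-s) hns (X.erase u)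
        (fun v hv => h0 v (Finset.mem_of_mem_erase hv))
        (fun a ha b hb => hc a (Finset.mem_of_mem_erase ha) b (Finset.mem_of_mem_erase hb)),
        neg_neg]
      have : ((X.erase u).filter fun v => lab v = -s * (k + 1)) = ∅ := by
        apply Finset.filter_eq_empty_iff.2
        intro v hv h
        apply hc u hu.1 v (Finset.mem_of_mem_erase hv)
        rw [h, hu.2]; ring
      rw [this, Finset.sum_empty, add_zero, Finset.filter_erase]
    rw [e1, e2, Finset.sum_congr rfl e3, Finset.sum_add_distrib,
      pair_sum_zero _ (fun u v => alt lab k (-s) ((X.erase u).erase v))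
        (fun u v => by rw [Finset.erase_right_comm]), add_zero, sum_split lab k s hs,
      ih s hs X h0 hc, Finset.sum_add_distrib]
    rw [alt, alt, neg_neg]
    have := CharTwo.add_self_eq_zero
      (∑ v ∈ X with lab v = s * (k + 1), alt lab k s (X.erase v))
    linear_combination this

end TuckerAux
namespace TuckerAux
open Finset

/-- Membership in the cone spanned by a finite set. -/
def Cone {E : Type*} [AddCommGroup E] [Module ℝ E] (η : Finset E) (x : E) : Prop :=
  ∃ c : E → ℝ, (∀ v ∈ η, 0 ≤ c v) ∧ ∑ v ∈ η, c v • v = x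

lemma exists_generic {E : Type*} [AddCommGroup E] [Module ℝ E] (V : Submodule ℝ E)
    (S : Finset (Submodule ℝ E)) (hS : ∀ p ∈ S, ¬ V ≤ p) : ∃ w ∈ V, ∀ p ∈ S, w ∉ p := by
  classical
  have h := Subspace.biUnion_ne_univ_of_top_notMem
    (s := S.image (fun p => p.comap V.subtype)) (by
      intro h
      obtain ⟨p, hp, h⟩ := Finset.mem_image.1 h
      apply hS p hp
      rwa [Submodule.comap_subtype_eq_top] at h)
  rw [Ne, Set.eq_univ_iff_forall, not_forall] at h
  obtain ⟨w, hw⟩ := h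
  refine ⟨w, w.2, fun p hp hwp => hw ?_⟩
  simp only [Set.mem_iUnion]
  exact ⟨p.comap V.subtype, Finset.mem_image_of_mem _ hp, hwp⟩

lemma Cone.mem_span {E : Type*} [AddCommGroup E] [Module ℝ E] {η : Finset E} {x : E}
    (h : Cone η x) : x ∈ Submodule.span ℝ (η : Set E) := by
  obtain ⟨c, _, rfl⟩ := h
  exact Submodule.sum_mem _ fun v hv => Submodule.smul_mem _ _ (Submodule.subset_span hv)

lemma pigeon {E : Type*} [AddCommGroup E] [Module ℝ E] (V : Submodule ℝ E)
    (S : Finset (Finset E)) (hcov : ∀ x ∈ V, ∃ η ∈ S, Cone η x) (w : E) (hw : w ∈ V)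
    (hgen : ∀ η ∈ S, ¬ V ≤ Submodule.span ℝ (η : Set E) → w ∉ Submodule.span ℝ (η : Set E))
    (x : E) (hx : x ∈ V) :
    ∃ η ∈ S, V ≤ Submodule.span ℝ (η : Set E) ∧
      ∃ᶠ m : ℕ in Filter.atTop, Cone η (x + (1 / ((m : ℝ) + 1)) • w) := by
  choose! f hfS hf using fun m : ℕ => hcov (x + (1 / ((m : ℝ) + 1)) • w)
    (V.add_mem hx (V.smul_mem _ hw))
  have h1 : ∃ η ∈ S, ∃ᶠ m : ℕ in Filter.atTop, f m = η := by
    by_contra hcon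
    push Not at hcon
    have : ∀ᶠ m : ℕ in Filter.atTop, ∀ η ∈ S, f m ≠ η := by
      rw [Filter.eventually_all_finset]
      intro η hη
      simpa [Filter.not_frequently] using hcon η hη
    obtain ⟨m, hm⟩ := this.exists
    exact hm _ (hfS m) rfl
  obtain ⟨η, hη, hfr⟩ := h1
  have hfr2 : ∃ᶠ m : ℕ in Filter.atTop, Cone η (x + (1 / ((m : ℝ) + 1)) • w) :=
    hfr.mono fun m hm => hm ▸ hf m
  refine ⟨η, hη, ?_, hfr2⟩
  by_contra hV
  apply hgen η hη hV
  obtain ⟨m, _, hm⟩ := (Filter.frequently_atTop.1 hfr2) 0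
  obtain ⟨m', hmm, hm'⟩ := (Filter.frequently_atTop.1 hfr2) (m + 1)
  have h3 := Submodule.sub_mem _ hm.mem_span hm'.mem_span
  have h4 : x + (1 / ((m : ℝ) + 1)) • w - (x + (1 / ((m' : ℝ) + 1)) • w)
      = (1 / ((m : ℝ) + 1) - 1 / ((m' : ℝ) + 1)) • w := by
    rw [sub_smul]; abel
  rw [h4] at h3
  have h5 : (1 / ((m : ℝ) + 1) - 1 / ((m' : ℝ) + 1)) ≠ 0 := by
    have : (m : ℝ) + 1 < (m' : ℝ) + 1 := by
      have : m < m' := by omega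
      have : (m : ℝ) < m' := by exact_mod_cast this
      linarith
    have := one_div_lt_one_div_of_lt (by positivity) this
    linarith
  exact (Submodule.smul_mem_iff _ h5).1 h3

lemma coef_unique {E : Type*} [AddCommGroup E] [Module ℝ E] {η : Finset E}
    (hη : LinearIndepOn ℝ id (η : Set E)) {c c' : E → ℝ}
    (h : ∑ v ∈ η, c v • v = ∑ v ∈ η, c' v • v) : ∀ v ∈ η, c v = c' v := by
  have h2 := linearIndepOn_finset_iff.1 hη (fun v => c v - c' v) (by
    simp only [sub_smul, Finset.sum_sub_distrib, id, h, sub_self])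
  intro v hv
  linarith [h2 v hv]

lemma cone_closed {E : Type*} [AddCommGroup E] [Module ℝ E] {η : Finset E}
    (hη : LinearIndepOn ℝ id (η : Set E)) {x w : E}
    (hfr : ∃ᶠ m : ℕ in Filter.atTop, Cone η (x + (1 / ((m : ℝ) + 1)) • w)) 
    (hx : x ∈ Submodule.span ℝ (η : Set E)) (hw : w ∈ Submodule.span ℝ (η : Set E)) :
    Cone η x := by
  obtain ⟨a, -, ha⟩ := Submodule.mem_span_finset.1 hx
  obtain ⟨b, -, hb⟩ := Submodule.mem_span_finset.1 hw
  refine ⟨a, fun v hv => ?_, ha⟩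
  have h1 : ∃ᶠ m : ℕ in Filter.atTop, 0 ≤ a v + (1 / ((m : ℝ) + 1)) * b v := by
    refine hfr.mono fun m hm => ?_
    obtain ⟨c, hc, hcs⟩ := hm
    have : ∑ v ∈ η, c v • v = ∑ v ∈ η, (a v + (1 / ((m : ℝ) + 1)) * b v) • v := by
      rw [hcs, ← ha, ← hb]
      simp only [add_smul, Finset.sum_add_distrib, Finset.smul_sum, mul_smul]
    rw [← coef_unique hη this v hv]
    exact hc v hv
  have h2 : Filter.Tendsto (fun m : ℕ => a v + (1 / ((m : ℝ) + 1)) * b v) Filter.atTop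
      (nhds (a v + 0 * b v)) :=
    (tendsto_one_div_add_atTop_nhds_zero_nat.mul_const _).const_add _
  simp only [zero_mul, add_zero] at h2
  by_contra hneg
  push Not at hneg
  have := h2.eventually_lt_const hneg
  obtain ⟨m, h, h'⟩ := (h1.and_eventually this).exists
  linarith

/-- The coordinate subspace of the first `d` coordinates. -/
def V (n d : ℕ) : Submodule ℝ (Fin (n + 1) → ℝ) where
  carrier := {x | ∀ i : Fin (n + 1), d ≤ i.val → x i = 0}
  add_mem' := by
    intro a b ha hb i hi
    simp [ha i hi, hb i hi]
  zero_mem' := by intro i _; rfl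
  smul_mem' := by
    intro c x hx i hi
    simp [hx i hi]

lemma mem_V {n d : ℕ} {x : Fin (n + 1) → ℝ} :
    x ∈ V n d ↔ ∀ i : Fin (n + 1), d ≤ i.val → x i = 0 := Iff.rfl

lemma finrank_V (n d : ℕ) (hd : d ≤ n + 1) : Module.finrank ℝ (V n d) = d := by
  have h : V n d = ⨅ i ∈ {i : Fin (n + 1) | d ≤ i.val},
      LinearMap.ker (LinearMap.proj i : (Fin (n + 1) → ℝ) →ₗ[ℝ] ℝ) := by
    ext x
    simp [mem_V, Submodule.mem_iInf]
  rw [h]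
  classical
  have e := LinearMap.iInfKerProjEquiv ℝ (fun _ : Fin (n + 1) => ℝ)
    (I := {i : Fin (n + 1) | i.val < d}) (J := {i : Fin (n + 1) | d ≤ i.val})
    (by
      rw [Set.disjoint_left]
      intro i hi hj
      simp only [Set.mem_ofPred_eq] at hi hj
      omega)
    (by
      intro i _
      simp only [Set.mem_union, Set.mem_ofPred_eq]
      omega)
  rw [LinearEquiv.finrank_eq e, Module.finrank_fintype_fun_eq_card, Fintype.card_subtype]
  simp only [Set.mem_ofPred_eq]
  rw [Fin.card_filter_val_lt]
  omega

lemma V_top (n : ℕ) : V n (n + 1) = ⊤ := by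
  ext x
  simp only [mem_V, Submodule.mem_top, iff_true]
  intro i hi
  omega

end TuckerAux
namespace TuckerAux
open Finset

variable {n : ℕ}

/-- Nondegenerate simplices. -/
def Good (T : SymmetricTriangulation n) (σ : Finset (Fin (n + 1) → ℝ)) : Prop :=
  σ ∈ T.simplices ∧ LinearIndepOn ℝ id (σ : Set (Fin (n + 1) → ℝ))

lemma hull_sphere (T : SymmetricTriangulation n) {σ : Finset (Fin (n + 1) → ℝ)}
    (hσ : σ ∈ T.simplices) {x : Fin (n + 1) → ℝ}
    (hx : x ∈ convexHull ℝ (σ : Set (Fin (n + 1) → ℝ))) : ∑ i, |x i| = 1 := by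
  have : x ∈ ⋃ σ ∈ T.simplices, convexHull ℝ (σ : Set (Fin (n + 1) → ℝ)) := by
    simp only [Set.mem_iUnion]
    exact ⟨σ, hσ, hx⟩
  rw [T.covers] at this
  exact this

lemma sphere_hull (T : SymmetricTriangulation n) {x : Fin (n + 1) → ℝ}
    (hx : ∑ i, |x i| = 1) :
    ∃ σ ∈ T.simplices, x ∈ convexHull ℝ (σ : Set (Fin (n + 1) → ℝ)) := by
  have : x ∈ {x : Fin (n + 1) → ℝ | ∑ i, |x i| = 1} := hx
  rw [← T.covers] at this
  simpa only [Set.mem_iUnion, exists_prop] using this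

lemma same_sign (T : SymmetricTriangulation n) {σ : Finset (Fin (n + 1) → ℝ)}
    (hσ : σ ∈ T.simplices) {u v : Fin (n + 1) → ℝ} (hu : u ∈ σ) (hv : v ∈ σ)
    (i : Fin (n + 1)) : 0 ≤ u i * v i := by
  have hm : (1 / 2 : ℝ) • u + (1 / 2 : ℝ) • v ∈ convexHull ℝ (σ : Set (Fin (n + 1) → ℝ)) :=
    (convex_convexHull ℝ _) (subset_convexHull ℝ _ hu) (subset_convexHull ℝ _ hv)
      (by norm_num) (by norm_num) (by norm_num)
  have h1 := hull_sphere T hσ hm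
  have h2 := T.vertices_on_sphere σ hσ u hu
  have h3 := T.vertices_on_sphere σ hσ v hv
  have h4 : ∑ i, ((1 / 2) * |u i| + (1 / 2) * |v i| - |(1 / 2) * u i + (1 / 2) * v i|) = 0 := by
    rw [Finset.sum_sub_distrib, Finset.sum_add_distrib, ← Finset.mul_sum, ← Finset.mul_sum, h2, h3]
    simp only [Pi.add_apply, Pi.smul_apply, smul_eq_mul] at h1
    rw [h1]; norm_num
  have h5 := (Finset.sum_eq_zero_iff_of_nonneg (by
    intro i _
    have := abs_add_le ((1 / 2) * u i) ((1 / 2) * v i)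
    rw [abs_mul, abs_mul, abs_of_pos (by norm_num : (0 : ℝ) < 1 / 2)] at this
    linarith)).1 h4 i (Finset.mem_univ i)
  by_contra hneg
  push Not at hneg
  rcases mul_neg_iff.1 hneg with ⟨a, b⟩ | ⟨a, b⟩
  · rw [abs_of_pos a, abs_of_neg b] at h5
    rcases abs_cases ((1 / 2) * u i + (1 / 2) * v i) with ⟨h, _⟩ | ⟨h, _⟩ <;> rw [h] at h5 <;>
      linarith
  · rw [abs_of_neg a, abs_of_pos b] at h5
    rcases abs_cases ((1 / 2) * u i + (1 / 2) * v i) with ⟨h, _⟩ | ⟨h, _⟩ <;> rw [h] at h5 <;>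
      linarith

lemma cone_zero (σ : Finset (Fin (n + 1) → ℝ)) : Cone σ 0 :=
  ⟨fun _ => 0, by simp, by simp⟩

lemma cone_of_hull {σ : Finset (Fin (n + 1) → ℝ)} {x : Fin (n + 1) → ℝ} {r : ℝ} (hr : 0 < r)
    (h : r⁻¹ • x ∈ convexHull ℝ (σ : Set (Fin (n + 1) → ℝ))) : Cone σ x := by
  obtain ⟨w, hw, -, hx⟩ := Finset.mem_convexHull'.1 h
  refine ⟨fun v => r * w v, fun v hv => mul_nonneg hr.le (hw v hv), ?_⟩
  simp only [mul_smul, ← Finset.smul_sum]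
  rw [hx, smul_smul, mul_inv_cancel₀ hr.ne', one_smul]

lemma l1_pos {x : Fin (n + 1) → ℝ} (hx : x ≠ 0) : 0 < ∑ i, |x i| := by
  obtain ⟨i, hi⟩ := Function.ne_iff.1 hx
  exact Finset.sum_pos' (fun i _ => abs_nonneg _) ⟨i, Finset.mem_univ i, abs_pos.2 hi⟩

lemma l1_smul {x : Fin (n + 1) → ℝ} {r : ℝ} (hr : 0 < r) :
    ∑ i, |(r⁻¹ • x) i| = r⁻¹ * ∑ i, |x i| := by
  simp only [Pi.smul_apply, smul_eq_mul, abs_mul, abs_of_pos (inv_pos.2 hr), Finset.mul_sum]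

lemma hull_of_cone (T : SymmetricTriangulation n) {σ : Finset (Fin (n + 1) → ℝ)}
    (hσ : σ ∈ T.simplices) {x : Fin (n + 1) → ℝ} (hx : x ≠ 0) (h : Cone σ x) :
    (∑ i, |x i|)⁻¹ • x ∈ convexHull ℝ (σ : Set (Fin (n + 1) → ℝ)) := by
  obtain ⟨c, hc, hs⟩ := h
  have hpos : 0 < ∑ v ∈ σ, c v := by
    rcases (Finset.sum_nonneg hc).lt_or_eq with h | h
    · exact h
    · exfalso
      apply hx
      have := (Finset.sum_eq_zero_iff_of_nonneg hc).1 h.symm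
      rw [← hs]
      exact Finset.sum_eq_zero fun v hv => by rw [this v hv, zero_smul]
  have h1 := Finset.centerMass_id_mem_convexHull σ hc hpos
  have h2 : σ.centerMass c id = (∑ v ∈ σ, c v)⁻¹ • x := by
    rw [Finset.centerMass, ← hs]; rfl
  rw [h2] at h1
  have h3 := hull_sphere T hσ h1
  rw [l1_smul hpos] at h3
  have h4 : ∑ i, |x i| = ∑ v ∈ σ, c v := by
    field_simp at h3
    linarith
  rwa [h4]

lemma cover_cone (T : SymmetricTriangulation n) (x : Fin (n + 1) → ℝ) :
    ∃ σ ∈ T.simplices, Cone σ x := by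
  by_cases hx : x = 0
  · have h1 : ∑ i, |(Pi.single 0 1 : Fin (n + 1) → ℝ) i| = 1 := by
      rw [Finset.sum_eq_single 0] <;> simp +contextual
    obtain ⟨σ, hσ, -⟩ := sphere_hull T h1
    exact ⟨σ, hσ, hx ▸ cone_zero σ⟩
  · have hpos := l1_pos hx
    obtain ⟨σ, hσ, h⟩ := sphere_hull T (x := (∑ i, |x i|)⁻¹ • x) (by
      rw [l1_smul hpos, inv_mul_cancel₀ hpos.ne'])
    exact ⟨σ, hσ, cone_of_hull hpos h⟩

lemma cone_inter (T : SymmetricTriangulation n) {σ σ' : Finset (Fin (n + 1) → ℝ)}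
    (hσ : σ ∈ T.simplices) (hσ' : σ' ∈ T.simplices) {x : Fin (n + 1) → ℝ}
    (h : Cone σ x) (h' : Cone σ' x) : Cone (σ ∩ σ') x := by
  by_cases hx : x = 0
  · exact hx ▸ cone_zero _
  · refine cone_of_hull (l1_pos hx) ?_
    rw [← T.face_inter σ hσ σ' hσ']
    exact ⟨hull_of_cone T hσ hx h, hull_of_cone T hσ' hx h'⟩

lemma coef_inter (T : SymmetricTriangulation n) {σ σ' : Finset (Fin (n + 1) → ℝ)}
    (hσ : Good T σ) (hσ' : Good T σ') {c c' : (Fin (n + 1) → ℝ) → ℝ}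
    (hc : ∀ v ∈ σ, 0 ≤ c v) (hc' : ∀ v ∈ σ', 0 ≤ c' v)
    (h : ∑ v ∈ σ, c v • v = ∑ v ∈ σ', c' v • v) :
    ∀ v ∈ σ, 0 < c v → v ∈ σ' ∧ 0 < c' v := by
  obtain ⟨b, -, hb⟩ := cone_inter T hσ.1 hσ'.1 ⟨c, hc, rfl⟩ ⟨c', hc', h.symm⟩
  have e1 : ∑ v ∈ σ, (if v ∈ σ' then b v else 0) • v = ∑ v ∈ σ, c v • v := by
    rw [← hb, ← Finset.filter_mem_eq_inter, Finset.sum_filter]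
    simp only [ite_smul, zero_smul]
  have e2 : ∑ v ∈ σ', (if v ∈ σ then b v else 0) • v = ∑ v ∈ σ', c' v • v := by
    rw [← h, ← hb, Finset.inter_comm, ← Finset.filter_mem_eq_inter, Finset.sum_filter]
    simp only [ite_smul, zero_smul]
  intro v hv hpos
  have h1 := coef_unique hσ.2 e1 v hv
  by_cases hv' : v ∈ σ'
  · refine ⟨hv', ?_⟩
    have h2 := coef_unique hσ'.2 e2 v hv'
    simp only [hv, hv', if_true] at h1 h2
    linarith
  · simp only [hv', if_false] at h1
    linarith

/-- The nondegenerate simplices cover. -/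
lemma cover_good (T : SymmetricTriangulation n) (x : Fin (n + 1) → ℝ) :
    ∃ σ, Good T σ ∧ Cone σ x := by
  classical
  obtain ⟨w, -, hw⟩ := exists_generic (⊤ : Submodule ℝ (Fin (n + 1) → ℝ))
    ((T.simplices.image fun σ : Finset (Fin (n + 1) → ℝ) => Submodule.span ℝ (σ : Set (Fin (n + 1) → ℝ))).filter
      (fun p => ¬ ⊤ ≤ p)) (fun p hp => (Finset.mem_filter.1 hp).2)
  obtain ⟨σ, hσ, htop, hfr⟩ := pigeon ⊤ T.simplices (fun x _ => cover_cone T x) w trivial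
    (fun η hη hn => hw _ (Finset.mem_filter.2 ⟨Finset.mem_image_of_mem _ hη, hn⟩)) x trivial
  have hli : LinearIndepOn ℝ id (σ : Set (Fin (n + 1) → ℝ)) := by
    apply linearIndependent_of_top_le_span_of_card_le_finrank
    · simpa using htop
    · simp [T.card_eq σ hσ]
  exact ⟨σ, ⟨hσ, hli⟩, cone_closed hli hfr (htop trivial) (htop trivial)⟩

lemma Good.neg {T : SymmetricTriangulation n} {σ : Finset (Fin (n + 1) → ℝ)} (h : Good T σ) :
    Good T (σ.image (fun v => -v)) := by
  refine ⟨T.symmetric σ h.1, ?_⟩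
  have h0 : LinearIndepOn ℝ (fun v : Fin (n + 1) → ℝ => -v) (σ : Set (Fin (n + 1) → ℝ)) :=
    LinearIndependent.map' h.2
      (LinearEquiv.neg ℝ : (Fin (n + 1) → ℝ) ≃ₗ[ℝ] _).toLinearMap (LinearEquiv.ker _)
  have h1 := h0.id_image
  convert h1 using 1
  ext v
  simp

/-- Cover of the coordinate subspaces. -/
lemma cover_V (T : SymmetricTriangulation n) (d : ℕ) {x : Fin (n + 1) → ℝ} {σ : Finset _}
    (hσ : Good T σ) (hx : x ∈ V n d) {c : (Fin (n + 1) → ℝ) → ℝ} (hc : ∀ v ∈ σ, 0 ≤ c v)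
    (h : ∑ v ∈ σ, c v • v = x) : ∀ v ∈ σ, 0 < c v → v ∈ V n d := by
  intro v hv hpos i hi
  have h1 : ∑ u ∈ σ, c u * (u i * v i) = 0 := by
    have : (∑ u ∈ σ, c u * u i) = 0 := by
      rw [← hx i hi, ← h]
      simp
    calc _ = (∑ u ∈ σ, c u * u i) * v i := by
          rw [Finset.sum_mul]; exact Finset.sum_congr rfl fun _ _ => by ring
      _ = 0 := by rw [this, zero_mul]
  have h2 := (Finset.sum_eq_zero_iff_of_nonneg
    (fun u hu => mul_nonneg (hc u hu) (same_sign T hσ.1 hu hv i))).1 h1 v hv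
  rcases mul_eq_zero.1 h2 with h | h
  · linarith
  · exact mul_self_eq_zero.1 h

end TuckerAux
namespace TuckerAux
open Finset

variable {n : ℕ}

/-- Nondegenerate `d`-vertex faces inside the `d`-th coordinate subspace. -/
def IsCell (T : SymmetricTriangulation n) (d : ℕ) (η : Finset (Fin (n + 1) → ℝ)) : Prop :=
  η.card = d ∧ (∀ v ∈ η, v ∈ V n d) ∧ ∃ σ, Good T σ ∧ η ⊆ σ

lemma IsCell.indep {T : SymmetricTriangulation n} {d : ℕ} {η : Finset (Fin (n + 1) → ℝ)}
    (h : IsCell T d η) : LinearIndepOn ℝ id (η : Set (Fin (n + 1) → ℝ)) := by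
  obtain ⟨_, _, σ, hσ, hs⟩ := h
  exact hσ.2.mono (by exact_mod_cast hs)

lemma IsCell.span {T : SymmetricTriangulation n} {d : ℕ} {η : Finset (Fin (n + 1) → ℝ)}
    (h : IsCell T d η) (hd : d ≤ n + 1) :
    Submodule.span ℝ (η : Set (Fin (n + 1) → ℝ)) = V n d := by
  apply Submodule.eq_of_le_of_finrank_eq
  · exact Submodule.span_le.2 h.2.1
  · rw [finrank_span_finset_eq_card h.indep, finrank_V n d hd, h.1]

lemma sum_coef {σ τ : Finset (Fin (n + 1) → ℝ)} {v : Fin (n + 1) → ℝ} (hv : v ∉ τ)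
    (hs : insert v τ ⊆ σ) (e : ℝ) (f : (Fin (n + 1) → ℝ) → ℝ) :
    ∑ u ∈ σ, (if u = v then e else if u ∈ τ then f u else 0) • u
      = e • v + ∑ u ∈ τ, f u • u := by
  rw [← Finset.sum_subset hs, Finset.sum_insert hv, if_pos rfl]
  · congr 1
    apply Finset.sum_congr rfl
    intro u hu
    rw [if_neg (by rintro rfl; exact hv hu), if_pos hu]
  · intro u _ hu
    rw [Finset.mem_insert, not_or] at hu
    rw [if_neg hu.1, if_neg hu.2, zero_smul]

lemma unique_side (T : SymmetricTriangulation n) (d : ℕ) {τ : Finset (Fin (n + 1) → ℝ)}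
    (ℓ : (Fin (n + 1) → ℝ) →ₗ[ℝ] ℝ)
    (hk : ∀ x ∈ V n (d + 1), ℓ x = 0 → x ∈ Submodule.span ℝ (τ : Set (Fin (n + 1) → ℝ)))
    {v v' : Fin (n + 1) → ℝ} (hv : v ∉ τ) (hv' : v' ∉ τ) (hℓ : 0 < ℓ v) (hℓ' : 0 < ℓ v')
    (hc : IsCell T (d + 1) (insert v τ)) (hc' : IsCell T (d + 1) (insert v' τ)) : v = v' := by
  obtain ⟨-, hV, σ, hσ, hs⟩ := hc
  obtain ⟨-, hV', σ', hσ', hs'⟩ := hc'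
  set a := ℓ v / ℓ v' with ha
  have hapos : 0 < a := div_pos hℓ hℓ'
  have h1 : v - a • v' ∈ Submodule.span ℝ (τ : Set (Fin (n + 1) → ℝ)) := by
    apply hk
    · exact Submodule.sub_mem _ (hV v (by simp)) (Submodule.smul_mem _ _ (hV' v' (by simp)))
    · rw [map_sub, map_smul, smul_eq_mul, ha]
      field_simp
      simp
  obtain ⟨b, -, hb⟩ := Submodule.mem_span_finset.1 h1
  set B := ∑ t ∈ τ, |b t| with hB
  have hB0 : 0 ≤ B := Finset.sum_nonneg fun _ _ => abs_nonneg _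
  set ε := 1 / (1 + B) with hε
  have hεpos : 0 < ε := by positivity
  have hbt : ∀ t ∈ τ, 0 ≤ 1 + ε * b t := by
    intro t ht
    have h2 : |b t| ≤ B := Finset.single_le_sum (f := fun t => |b t|)
      (fun _ _ => abs_nonneg _) ht
    have h3 : -B ≤ b t := by linarith [neg_abs_le (b t)]
    have h4 : ε * (1 + B) = 1 := by rw [hε]; field_simp
    nlinarith
  have h5 := coef_inter T hσ hσ'
    (c := fun u => if u = v then ε else if u ∈ τ then 1 else 0)
    (c' := fun u => if u = v' then ε * a else if u ∈ τ then 1 + ε * b u else 0)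
    (by
      intro u _
      split_ifs <;> linarith)
    (by
      intro u _
      split_ifs with h1 h2
      · positivity
      · exact hbt u h2
      · exact le_rfl)
    (by
      rw [sum_coef hv hs, sum_coef hv' hs']
      have : v = a • v' + ∑ u ∈ τ, b u • u := by rw [hb]; abel
      conv_lhs => rw [this]
      simp only [add_smul, Finset.sum_add_distrib, smul_add, mul_smul, ← Finset.smul_sum]
      abel)
    v (hs (by simp)) (by simp only [if_true]; exact hεpos)
  by_contra hne
  have := h5.2
  rw [if_neg hne, if_neg hv] at this
  exact lt_irrefl _ this

lemma exists_side (T : SymmetricTriangulation n) (d : ℕ) (hd : d + 1 ≤ n + 1)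
    {τ σ₀ : Finset (Fin (n + 1) → ℝ)} (hσ₀ : Good T σ₀) (hτσ : τ ⊆ σ₀)
    (hτV : ∀ t ∈ τ, t ∈ V n (d + 1)) (hcard : τ.card = d)
    (ℓ : (Fin (n + 1) → ℝ) →ₗ[ℝ] ℝ) (hℓ : ∀ t ∈ τ, ℓ t = 0)
    (hk : ∀ x ∈ V n (d + 1), ℓ x = 0 → x ∈ Submodule.span ℝ (τ : Set (Fin (n + 1) → ℝ))) :
    ∃ v, v ∉ τ ∧ 0 < ℓ v ∧ IsCell T (d + 1) (insert v τ) := by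
  classical
  set S : Finset (Finset (Fin (n + 1) → ℝ)) :=
    (T.simplices.filter (fun σ => Good T σ)).image (fun σ => σ.filter (fun v => v ∈ V n (d + 1)))
    with hS
  have hmemS : ∀ η ∈ S, ∃ σ, Good T σ ∧ σ.filter (fun v => v ∈ V n (d + 1)) = η := by
    intro η hη
    obtain ⟨σ, hσ, rfl⟩ := Finset.mem_image.1 hη
    exact ⟨σ, (Finset.mem_filter.1 hσ).2, rfl⟩
  have hcov : ∀ x ∈ V n (d + 1), ∃ η ∈ S, Cone η x := by
    intro x hx
    obtain ⟨σ, hσ, c, hc, hs⟩ := cover_good T x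
    refine ⟨σ.filter (fun v => v ∈ V n (d + 1)), Finset.mem_image_of_mem _
      (Finset.mem_filter.2 ⟨hσ.1, hσ⟩), c, fun v hv => hc v (Finset.mem_filter.1 hv).1, ?_⟩
    rw [← hs]
    apply Finset.sum_subset (Finset.filter_subset _ _)
    intro v hv hv'
    have h1 := cover_V T (d + 1) hσ hx hc hs v hv
    have h2 : ¬ 0 < c v := fun h => hv' (Finset.mem_filter.2 ⟨hv, h1 h⟩)
    have h3 : c v = 0 := le_antisymm (not_lt.1 h2) (hc v hv)
    rw [h3, zero_smul]
  have hVτ : ¬ V n (d + 1) ≤ Submodule.span ℝ (τ : Set (Fin (n + 1) → ℝ)) := by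
    intro h
    have h1 := Submodule.finrank_mono h
    have h2 := finrank_span_finset_le_card (R := ℝ) τ
    rw [Set.finrank] at h2
    rw [finrank_V n _ hd] at h1
    omega
  obtain ⟨w₀, hw₀V, hw₀⟩ := exists_generic (V n (d + 1))
    (insert (LinearMap.ker ℓ)
      ((S.image fun σ : Finset (Fin (n + 1) → ℝ) =>
        Submodule.span ℝ (σ : Set (Fin (n + 1) → ℝ))).filter (fun p => ¬ V n (d + 1) ≤ p))) (by
      intro p hp
      rcases Finset.mem_insert.1 hp with rfl | hp
      · intro h
        exact hVτ fun x hx => hk x hx (h hx)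
      · exact (Finset.mem_filter.1 hp).2)
  have hw : ∃ w ∈ V n (d + 1), 0 < ℓ w ∧ ∀ η ∈ S,
      ¬ V n (d + 1) ≤ Submodule.span ℝ (η : Set (Fin (n + 1) → ℝ)) →
      w ∉ Submodule.span ℝ (η : Set (Fin (n + 1) → ℝ)) := by
    have hne : ℓ w₀ ≠ 0 := hw₀ _ (Finset.mem_insert_self _ _)
    have hg : ∀ η ∈ S, ¬ V n (d + 1) ≤ Submodule.span ℝ (η : Set (Fin (n + 1) → ℝ)) →
      w₀ ∉ Submodule.span ℝ (η : Set (Fin (n + 1) → ℝ)) := fun η hη hn =>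
        hw₀ _ (Finset.mem_insert_of_mem
          (Finset.mem_filter.2 ⟨Finset.mem_image_of_mem _ hη, hn⟩))
    rcases lt_or_gt_of_ne hne with h | h
    · refine ⟨-w₀, Submodule.neg_mem _ hw₀V, by rw [map_neg]; linarith, fun η hη hn hm => ?_⟩
      exact hg η hη hn (by simpa using Submodule.neg_mem _ hm)
    · exact ⟨w₀, hw₀V, h, hg⟩
  obtain ⟨w, hwV, hwℓ, hwg⟩ := hw
  have hpV : ∑ t ∈ τ, (1 : ℝ) • t ∈ V n (d + 1) :=
    Submodule.sum_mem _ fun t ht => Submodule.smul_mem _ _ (hτV t ht)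
  obtain ⟨η, hηS, hηV, hfr⟩ := pigeon _ S hcov w hwV hwg _ hpV
  obtain ⟨σ, hσ, hση⟩ := hmemS η hηS
  have hησ : η ⊆ σ := hση ▸ Finset.filter_subset _ _
  have hηV' : ∀ v ∈ η, v ∈ V n (d + 1) := by
    intro v hv
    rw [← hση] at hv
    exact (Finset.mem_filter.1 hv).2
  have hηi : LinearIndepOn ℝ id (η : Set (Fin (n + 1) → ℝ)) := hσ.2.mono (by exact_mod_cast hησ)
  have hηc : η.card = d + 1 := by
    have h1 : Submodule.span ℝ (η : Set (Fin (n + 1) → ℝ)) = V n (d + 1) :=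
      le_antisymm (Submodule.span_le.2 hηV') hηV
    rw [← finrank_span_finset_eq_card hηi, h1, finrank_V n _ hd]
  have hcell : IsCell T (d + 1) η := ⟨hηc, hηV', σ, hσ, hησ⟩
  obtain ⟨c, hc, hcs⟩ := cone_closed hηi hfr (hηV hpV) (hηV hwV)
  have hτη : τ ⊆ η := by
    intro t ht
    have h1 := coef_inter T hσ₀ hσ (c := fun u => if u ∈ τ then 1 else 0)
      (c' := fun u => if u ∈ η then c u else 0)
      (by intro u _; split_ifs <;> norm_num)
      (by
        intro u _
        split_ifs with h
        · exact hc u h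
        · exact le_rfl)
      (by
        rw [← Finset.sum_subset hτσ, ← Finset.sum_subset hησ]
        · rw [Finset.sum_congr rfl (g := fun u => (1 : ℝ) • u)
            (fun u hu => by rw [if_pos hu]), ← hcs]
          exact Finset.sum_congr rfl (fun u hu => by rw [if_pos hu])
        · intro u _ hu; rw [if_neg hu, zero_smul]
        · intro u _ hu; rw [if_neg hu, zero_smul])
      t (hτσ ht) (by simp [ht])
    by_contra hne
    have := h1.2
    rw [if_neg hne] at this
    exact lt_irrefl _ this
  obtain ⟨v, hv, hvη⟩ := Finset.exists_eq_insert_iff.2 ⟨hτη, by omega⟩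
  refine ⟨v, hv, ?_, hvη ▸ hcell⟩
  obtain ⟨m, c', hc', hcs'⟩ := hfr.exists
  have h1 := congrArg ℓ hcs'
  rw [← hvη, Finset.sum_insert hv, map_add, map_add, map_sum, map_sum, map_smul, map_smul,
    Finset.sum_eq_zero (fun t ht => by rw [map_smul, hℓ t ht, smul_zero]),
    Finset.sum_eq_zero (fun t ht => by rw [map_smul, hℓ t ht, smul_zero]),
    smul_eq_mul, smul_eq_mul, add_zero, zero_add] at h1
  have h2 : 0 < 1 / ((m : ℝ) + 1) * ℓ w := by positivity
  have h3 : 0 ≤ c' v := hc' v (hvη ▸ Finset.mem_insert_self _ _)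
  rw [← h1] at h2
  exact (pos_iff_pos_of_mul_pos h2).1 (lt_of_le_of_ne h3 (by
    intro h; rw [← h, zero_mul] at h2; exact lt_irrefl _ h2))

end TuckerAux
namespace TuckerAux
open Finset

variable {n : ℕ}

open Classical in
/-- The finite set of cells. -/
noncomputable def cells (T : SymmetricTriangulation n) (d : ℕ) :
    Finset (Finset (Fin (n + 1) → ℝ)) :=
  (T.simplices.biUnion fun σ => σ.powerset).filter (fun η => IsCell T d η)

lemma mem_cells {T : SymmetricTriangulation n} {d : ℕ} {η : Finset (Fin (n + 1) → ℝ)} :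
    η ∈ cells T d ↔ IsCell T d η := by
  classical
  unfold cells
  rw [Finset.mem_filter]
  refine ⟨fun h => h.2, fun h => ⟨?_, h⟩⟩
  obtain ⟨_, _, σ, hσ, hs⟩ := h
  exact Finset.mem_biUnion.2 ⟨σ, hσ.1, Finset.mem_powerset.2 hs⟩

/-- Cells in the upper closed hemisphere. -/
def IsUp (T : SymmetricTriangulation n) (i : Fin (n + 1)) (η : Finset (Fin (n + 1) → ℝ)) : Prop :=
  IsCell T (i + 1) η ∧ ∀ v ∈ η, 0 ≤ v i

lemma mem_V_of_succ {i : Fin (n + 1)} {x : Fin (n + 1) → ℝ} (h : x ∈ V n (i + 1))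
    (h0 : x i = 0) : x ∈ V n i := by
  intro j hj
  rcases hj.lt_or_eq with h1 | h1
  · exact h j h1
  · rw [← Fin.ext h1]; exact h0

lemma V_mono {i : Fin (n + 1)} {x : Fin (n + 1) → ℝ} (h : x ∈ V n i) : x ∈ V n (i + 1) :=
  fun j hj => h j (by omega)

lemma IsCell.exists_ne {T : SymmetricTriangulation n} {i : Fin (n + 1)}
    {η : Finset (Fin (n + 1) → ℝ)} (h : IsCell T (i + 1) η) : ∃ v ∈ η, v i ≠ 0 := by
  by_contra hcon
  push Not at hcon
  have h1 : Submodule.span ℝ (η : Set (Fin (n + 1) → ℝ)) ≤ V n i :=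
    Submodule.span_le.2 fun v hv => mem_V_of_succ (h.2.1 v hv) (hcon v hv)
  have h2 := Submodule.finrank_mono h1
  rw [finrank_span_finset_eq_card h.indep, finrank_V n _ (by omega), h.1] at h2
  omega

lemma IsCell.sign {T : SymmetricTriangulation n} {d : ℕ}
    {η : Finset (Fin (n + 1) → ℝ)} (h : IsCell T d η) {t : Fin (n + 1) → ℝ} (ht : t ∈ η)
    {i : Fin (n + 1)} (hpos : 0 < t i) : ∀ v ∈ η, 0 ≤ v i := by
  obtain ⟨_, _, σ, hσ, hs⟩ := h
  intro v hv
  exact nonneg_of_mul_nonneg_right (same_sign T hσ.1 (hs ht) (hs hv) i) hpos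

lemma IsCell.neg {T : SymmetricTriangulation n} {d : ℕ}
    {η : Finset (Fin (n + 1) → ℝ)} (h : IsCell T d η) : IsCell T d (η.image (fun v => -v)) := by
  obtain ⟨h1, h2, σ, hσ, hs⟩ := h
  refine ⟨by rw [Finset.card_image_of_injective _ neg_injective, h1], ?_, _, hσ.neg,
    Finset.image_subset_image hs⟩
  intro v hv
  obtain ⟨u, hu, rfl⟩ := Finset.mem_image.1 hv
  exact Submodule.neg_mem _ (h2 u hu)

lemma neg_neg_image (η : Finset (Fin (n + 1) → ℝ)) :
    (η.image (fun v => -v)).image (fun v => -v) = η := by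
  ext v
  simp

lemma insert_of_cell {T : SymmetricTriangulation n} {d : ℕ} {τ σ : Finset (Fin (n + 1) → ℝ)}
    (h : IsCell T (d + 1) σ) (hc : τ.card = d) (hs : τ ⊆ σ) : ∃ v ∉ τ, insert v τ = σ :=
  Finset.exists_eq_insert_iff.2 ⟨hs, by rw [h.1, hc]⟩

open Classical in
lemma count_up (T : SymmetricTriangulation n) (i : Fin (n + 1))
    (τ : Finset (Fin (n + 1) → ℝ)) (hc : τ.card = i) :
    ((((cells T (i + 1)).filter (fun σ => IsUp T i σ)).filter (fun σ => τ ⊆ σ)).card : ZMod 2)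
      = if IsCell T i τ then 1 else 0 := by
  have hmem : ∀ σ, σ ∈ (((cells T (i + 1)).filter (fun σ => IsUp T i σ)).filter
      (fun σ => τ ⊆ σ)) ↔ IsUp T i σ ∧ τ ⊆ σ := by
    intro σ
    rw [Finset.mem_filter, Finset.mem_filter, mem_cells]
    exact ⟨fun h => ⟨h.1.2, h.2⟩, fun h => ⟨⟨h.1.1, h.1⟩, h.2⟩⟩
  generalize (((cells T (i + 1)).filter (fun σ => IsUp T i σ)).filter
      (fun σ => τ ⊆ σ)) = Q at hmem
  have hd : (i : ℕ) + 1 ≤ n + 1 := by omega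
  by_cases hcell : IsCell T i τ
  · rw [if_pos hcell]
    obtain ⟨-, hτV, σ₀, hσ₀, hτσ⟩ := id hcell
    have hk : ∀ x ∈ V n (i + 1), (LinearMap.proj i : (Fin (n + 1) → ℝ) →ₗ[ℝ] ℝ) x = 0 →
        x ∈ Submodule.span ℝ (τ : Set (Fin (n + 1) → ℝ)) := by
      intro x hx h0
      rw [hcell.span (by omega)]
      exact mem_V_of_succ hx h0
    obtain ⟨v, hv, hvpos, hvc⟩ := exists_side T i hd hσ₀ hτσ (fun t ht => V_mono (hτV t ht)) hc
      (LinearMap.proj i) (fun t ht => hτV t ht i le_rfl) hk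
    have hQ : Q = {insert v τ} := by
      ext σ
      rw [hmem, Finset.mem_singleton]
      constructor
      · rintro ⟨hup, hs⟩
        obtain ⟨v', hv', rfl⟩ := insert_of_cell hup.1 hc hs
        have h1 : 0 ≤ v' i := hup.2 v' (Finset.mem_insert_self _ _)
        have h2 : v' i ≠ 0 := by
          intro h0
          obtain ⟨u, hu, hu0⟩ := hup.1.exists_ne
          rcases Finset.mem_insert.1 hu with rfl | hu
          · exact hu0 h0
          · exact hu0 (hτV u hu i le_rfl)
        rw [unique_side T i (LinearMap.proj i) hk hv hv' hvpos
          (lt_of_le_of_ne h1 (Ne.symm h2)) hvc hup.1]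
      · rintro rfl
        exact ⟨⟨hvc, hvc.sign (Finset.mem_insert_self _ _) hvpos⟩, Finset.subset_insert _ _⟩
    rw [hQ, Finset.card_singleton, Nat.cast_one]
  · rw [if_neg hcell]
    rcases Q.eq_empty_or_nonempty with rfl | ⟨σ₁, hσ₁⟩
    · simp
    obtain ⟨hup₁, hs₁⟩ := (hmem σ₁).1 hσ₁
    obtain ⟨v₁, hv₁, rfl⟩ := insert_of_cell hup₁.1 hc hs₁
    obtain ⟨-, hV₁, σ₀, hσ₀, hsub⟩ := id hup₁.1
    have hτσ := hs₁.trans hsub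
    have hτV : ∀ t ∈ τ, t ∈ V n (i + 1) := fun t ht => hV₁ t (hs₁ ht)
    have hns : ∀ v ∉ τ, IsCell T (i + 1) (insert v τ) →
        v ∉ Submodule.span ℝ (τ : Set (Fin (n + 1) → ℝ)) := by
      intro v hv h
      have h1 := h.indep
      rw [Finset.coe_insert, linearIndepOn_id_insert (by exact_mod_cast hv)] at h1
      exact h1.2
    obtain ⟨ℓ, hℓ₁, hker⟩ := Submodule.exists_le_ker_of_notMem (hns v₁ hv₁ hup₁.1)
    have hℓ : ∀ t ∈ τ, ℓ t = 0 := fun t ht => hker (Submodule.subset_span ht)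
    have hk : ∀ x ∈ V n (i + 1), ℓ x = 0 →
        x ∈ Submodule.span ℝ (τ : Set (Fin (n + 1) → ℝ)) := by
      intro x hx h0
      rw [← hup₁.1.span hd, Finset.coe_insert, Submodule.mem_span_insert] at hx
      obtain ⟨a, z, hz, rfl⟩ := hx
      have hz0 : ℓ z = 0 := hker hz
      rw [map_add, hz0, add_zero, map_smul, smul_eq_mul] at h0
      rcases mul_eq_zero.1 h0 with h | h
      · rw [h, zero_smul, zero_add]; exact hz
      · exact absurd h hℓ₁
    have hk' : ∀ x ∈ V n (i + 1), (-ℓ) x = 0 →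
        x ∈ Submodule.span ℝ (τ : Set (Fin (n + 1) → ℝ)) := by
      intro x hx h0
      exact hk x hx (by simpa using h0)
    obtain ⟨a, ha, hapos, hac⟩ := exists_side T i hd hσ₀ hτσ hτV hc ℓ hℓ hk
    obtain ⟨b, hb, hbpos, hbc⟩ := exists_side T i hd hσ₀ hτσ hτV hc (-ℓ)
      (fun t ht => by simp [hℓ t ht]) hk'
    have hpos : ∃ t ∈ τ, 0 < t i := by
      by_contra hcon
      push Not at hcon
      apply hcell
      refine ⟨hc, fun t ht => mem_V_of_succ (hτV t ht) ?_, σ₀, hσ₀, hτσ⟩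
      exact le_antisymm (hcon t ht) (hup₁.2 t (hs₁ ht))
    obtain ⟨t, ht, htpos⟩ := hpos
    have hQ : Q = {insert a τ, insert b τ} := by
      ext σ
      rw [hmem, Finset.mem_insert, Finset.mem_singleton]
      constructor
      · rintro ⟨hup, hs⟩
        obtain ⟨v, hv, rfl⟩ := insert_of_cell hup.1 hc hs
        have hne : ℓ v ≠ 0 := fun h0 => hns v hv hup.1
          (hk v (hup.1.2.1 v (Finset.mem_insert_self _ _)) h0)
        rcases lt_or_gt_of_ne hne with h | h
        · right
          rw [unique_side T i (-ℓ) hk' hv hb (by simpa using h) hbpos hup.1 hbc]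
        · left
          rw [unique_side T i ℓ hk hv ha h hapos hup.1 hac]
      · rintro (rfl | rfl)
        · exact ⟨⟨hac, hac.sign (Finset.mem_insert_of_mem ht) htpos⟩, Finset.subset_insert _ _⟩
        · exact ⟨⟨hbc, hbc.sign (Finset.mem_insert_of_mem ht) htpos⟩, Finset.subset_insert _ _⟩
    have hab : insert a τ ≠ insert b τ := by
      intro h
      have h1 : a ∈ insert b τ := h ▸ Finset.mem_insert_self _ _
      rcases Finset.mem_insert.1 h1 with rfl | h1
      · simp only [LinearMap.neg_apply] at hbpos
        linarith
      · exact ha h1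
    rw [hQ, Finset.card_pair hab]
    rfl

lemma sum_erase_eq (σ : Finset (Fin (n + 1) → ℝ)) (d : ℕ) (hc : σ.card = d + 1)
    (F : Finset (Fin (n + 1) → ℝ) → ZMod 2) :
    ∑ v ∈ σ, F (σ.erase v) = ∑ τ ∈ σ.powersetCard d, F τ := by
  apply Finset.sum_bij (fun v _ => σ.erase v)
  · intro v hv
    rw [Finset.mem_powersetCard]
    exact ⟨Finset.erase_subset _ _, by rw [Finset.card_erase_of_mem hv, hc]; rfl⟩
  · intro a ha b hb h
    exact Finset.erase_injOn _ ha hb h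
  · intro τ hτ
    rw [Finset.mem_powersetCard] at hτ
    obtain ⟨v, hv, rfl⟩ := Finset.exists_eq_insert_iff.2 ⟨hτ.1, by rw [hτ.2, hc]⟩
    exact ⟨v, Finset.mem_insert_self _ _, Finset.erase_insert hv⟩
  · intros; rfl

lemma step (T : SymmetricTriangulation n) (lab : (Fin (n + 1) → ℝ) → ℤ)
    (hrange : ∀ σ ∈ T.simplices, ∀ v ∈ σ, 1 ≤ |lab v| ∧ |lab v| ≤ n)
    (hanti : ∀ σ ∈ T.simplices, ∀ v ∈ σ, lab (-v) = -lab v)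
    (hno : ∀ σ ∈ T.simplices, ∀ u ∈ σ, ∀ v ∈ σ, lab u + lab v ≠ 0) (i : Fin (n + 1)) :
    ∑ η ∈ cells T (i + 1), alt lab n 1 η = ∑ η ∈ cells T i, alt lab n 1 η := by
  classical
  set U := (cells T (i + 1)).filter (fun σ => IsUp T i σ) with hU
  have hUm : ∀ σ, σ ∈ U ↔ IsUp T i σ := by
    intro σ
    rw [hU, Finset.mem_filter, mem_cells]
    exact ⟨fun h => h.2, fun h => ⟨h.1, h⟩⟩
  -- left side
  have hL : ∑ σ ∈ U, ∑ v ∈ σ, alt lab n 1 (σ.erase v)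
      = ∑ η ∈ cells T (i + 1), alt lab n 1 η := by
    have h1 : ∀ σ ∈ U, ∑ v ∈ σ, alt lab n 1 (σ.erase v)
        = alt lab n 1 σ + alt lab n (-1) σ := by
      intro σ hσ
      obtain ⟨_, _, ρ, hρ, hs⟩ := ((hUm σ).1 hσ).1
      rw [← alt_parity lab n 1 (Or.inl rfl) σ, Finset.filter_true_of_mem]
      · intro v hv
        exact (hrange ρ hρ.1 v (hs hv)).2
      · intro v hv h0
        have := (hrange ρ hρ.1 v (hs hv)).1
        rw [h0] at this
        norm_num at this
      · intro u hu v hv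
        exact hno ρ hρ.1 u (hs hu) v (hs hv)
    rw [Finset.sum_congr rfl h1, Finset.sum_add_distrib,
      ← Finset.sum_filter_add_sum_filter_not (cells T (i + 1)) (fun σ => IsUp T i σ)]
    congr 1
    refine Finset.sum_bij' (fun σ _ => σ.image (fun v => -v))
      (fun σ _ => σ.image (fun v => -v)) ?_ ?_ ?_ ?_ ?_
    · intro σ hσ
      have hup := (hUm σ).1 hσ
      rw [Finset.mem_filter, mem_cells]
      refine ⟨hup.1.neg, fun h => ?_⟩
      obtain ⟨v, hv, hne⟩ := hup.1.exists_ne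
      have h1 := hup.2 v hv
      have h2 := h.2 (-v) (Finset.mem_image_of_mem _ hv)
      simp only [Pi.neg_apply] at h2
      exact hne (by linarith)
    · intro σ hσ
      rw [Finset.mem_filter, mem_cells] at hσ
      rw [hUm]
      refine ⟨hσ.1.neg, ?_⟩
      obtain ⟨v, hv, hne⟩ := hσ.1.exists_ne
      rcases lt_or_gt_of_ne hne with h | h
      · exact hσ.1.neg.sign (Finset.mem_image_of_mem _ hv) (by simpa using h)
      · exact absurd ⟨hσ.1, hσ.1.sign hv h⟩ hσ.2
    · intro σ _; exact neg_neg_image σ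
    · intro σ _; exact neg_neg_image σ
    · intro σ hσ
      obtain ⟨_, _, ρ, hρ, hs⟩ := ((hUm σ).1 hσ).1
      rw [alt_neg lab n 1 σ fun v hv => hanti ρ hρ.1 v (hs hv)]
  rw [← hL]
  have h2 : ∑ σ ∈ U, ∑ v ∈ σ, alt lab n 1 (σ.erase v)
      = ∑ σ ∈ U, ∑ τ ∈ σ.powersetCard i, alt lab n 1 τ :=
    Finset.sum_congr rfl fun σ hσ => sum_erase_eq σ i ((hUm σ).1 hσ).1.1 _
  rw [h2]
  set W := ((U.biUnion fun σ => σ.powersetCard i) ∪ cells T i) with hW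
  have hWc : ∀ τ ∈ W, τ.card = i := by
    intro τ hτ
    rcases Finset.mem_union.1 hτ with h | h
    · obtain ⟨σ, _, h⟩ := Finset.mem_biUnion.1 h
      exact (Finset.mem_powersetCard.1 h).2
    · exact (mem_cells.1 h).1
  rw [Finset.sum_comm' (t' := W) (s' := fun τ => U.filter (fun σ => τ ⊆ σ))]
  · have h3 : ∀ τ ∈ W, ∑ σ ∈ U.filter (fun σ => τ ⊆ σ), alt lab n 1 τ
        = if IsCell T i τ then alt lab n 1 τ else 0 := by
      intro τ hτ
      rw [Finset.sum_const, nsmul_eq_mul, count_up T i τ (hWc τ hτ), ite_mul, one_mul, zero_mul]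
    rw [Finset.sum_congr rfl h3, ← Finset.sum_filter]
    apply Finset.sum_congr _ fun _ _ => rfl
    ext τ
    rw [Finset.mem_filter, mem_cells]
    exact ⟨fun h => h.2, fun h => ⟨Finset.mem_union_right _ (mem_cells.2 h), h⟩⟩
  · intro σ τ
    constructor
    · rintro ⟨h1, h2⟩
      exact ⟨Finset.mem_filter.2 ⟨h1, (Finset.mem_powersetCard.1 h2).1⟩,
        Finset.mem_union_left _ (Finset.mem_biUnion.2 ⟨σ, h1, h2⟩)⟩
    · rintro ⟨h1, h2⟩
      rw [Finset.mem_filter] at h1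
      exact ⟨h1.1, Finset.mem_powersetCard.2 ⟨h1.2, hWc τ h2⟩⟩

end TuckerAux

/-- **Tucker's Lemma on the cross-polytope boundary.** Given a centrally symmetric
triangulation `T` of `C^n` and a labeling of its vertices by `{±1, …, ±n}` with
`λ(-x) = -λ(x)`, there exists an edge of `T` (two distinct vertices of a common simplex)
whose labels sum to zero. -/
theorem tucker_lemma (n : ℕ) (T : SymmetricTriangulation n)
    (lab : (Fin (n + 1) → ℝ) → ℤ)
    (hrange : ∀ σ ∈ T.simplices, ∀ v ∈ σ, 1 ≤ |lab v| ∧ |lab v| ≤ n)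
    (hanti : ∀ σ ∈ T.simplices, ∀ v ∈ σ, lab (-v) = -lab v) :
    ∃ σ ∈ T.simplices, ∃ u ∈ σ, ∃ v ∈ σ, u ≠ v ∧ lab u + lab v = 0 := by
  by_contra hcon
  have hno : ∀ σ ∈ T.simplices, ∀ u ∈ σ, ∀ v ∈ σ, lab u + lab v ≠ 0 := by
    intro σ hσ u hu v hv h
    refine hcon ⟨σ, hσ, u, hu, v, hv, ?_, h⟩
    rintro rfl
    have h1 := (hrange σ hσ u hu).1
    have h2 : lab u = 0 := by omega
    rw [h2] at h1
    norm_num at h1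
  have key : ∀ d : ℕ, d ≤ n + 1 →
      ∑ η ∈ TuckerAux.cells T d, TuckerAux.alt lab n 1 η = 1 := by
    intro d
    induction d with
    | zero =>
      intro _
      have h0 : TuckerAux.cells T 0 = {∅} := by
        ext η
        rw [TuckerAux.mem_cells, Finset.mem_singleton]
        constructor
        · intro h
          exact Finset.card_eq_zero.1 h.1
        · rintro rfl
          obtain ⟨σ, hσ, -⟩ := TuckerAux.cover_good T 0
          exact ⟨rfl, by simp, σ, hσ, Finset.empty_subset _⟩
      rw [h0, Finset.sum_singleton, TuckerAux.alt_empty]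
    | succ d ih =>
      intro hd
      rw [← ih (by omega)]
      exact TuckerAux.step T lab hrange hanti hno ⟨d, by omega⟩
  have h1 := key (n + 1) le_rfl
  rw [Finset.sum_eq_zero] at h1
  · exact zero_ne_one h1
  · intro η hη
    apply TuckerAux.alt_card
    rw [(TuckerAux.mem_cells.1 hη).1]
    omega
end

section
/- Every instance of the ε-Generalized Circuit problem has a solution: for any generalized circuit S = (V, T) with gates of types {constant, scaled copy, equality, addition, subtraction, comparison, OR, AND, NOT} (each node the output of at most one gate) and any ε > 0, there exists an assignment x ∈ [0,1]^V satisfying all the ε-approximate gate constraints. -/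
/-- A gate of a generalized circuit over a set `V` of nodes. -/
inductive Gate (V : Type*) where
  | const (α : ℝ) (out : V)
  | scale (α : ℝ) (inp out : V)
  | assign (inp out : V)
  | add (in1 in2 out : V)
  | sub (in1 in2 out : V)
  | lt (in1 in2 out : V)
  | lor (in1 in2 out : V)
  | land (in1 in2 out : V)
  | lnot (inp out : V)

/-- The output node of a gate. -/
def Gate.out {V : Type*} : Gate V → V
  | .const _ o => o
  | .scale _ _ o => o
  | .assign _ o => o
  | .add _ _ o => o
  | .sub _ _ o => o
  | .lt _ _ o => o
  | .lor _ _ o => o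
  | .land _ _ o => o
  | .lnot _ o => o

/-- The parameter `α` of a gate is admissible: `α ∈ [0,1]` for a constant gate and
`α ∈ (0,1]` for a multiplication-by-scalar gate. -/
def Gate.paramOK {V : Type*} : Gate V → Prop
  | .const α _ => α ∈ Set.Icc (0 : ℝ) 1
  | .scale α _ _ => α ∈ Set.Ioc (0 : ℝ) 1
  | _ => True

/-- The `ε`-approximate constraint of a gate on an assignment `x : V → ℝ`
(Table 1 of the paper). -/
def Gate.sat {V : Type*} (ε : ℝ) (x : V → ℝ) : Gate V → Prop
  | .const α o => |x o - α| ≤ ε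
  | .scale α i o => |x o - α * x i| ≤ ε
  | .assign i o => |x o - x i| ≤ ε
  | .add a b o => |x o - min (x a + x b) 1| ≤ ε
  | .sub a b o => |x o - max (x a - x b) 0| ≤ ε
  | .lt a b o =>
      (x a < x b - ε → |x o - 1| ≤ ε) ∧ (x a > x b + ε → |x o| ≤ ε)
  | .lor a b o =>
      ((|x a - 1| ≤ ε ∨ |x b - 1| ≤ ε) → |x o - 1| ≤ ε) ∧
      ((|x a| ≤ ε ∧ |x b| ≤ ε) → |x o| ≤ ε)
  | .land a b o =>
      ((|x a - 1| ≤ ε ∧ |x b - 1| ≤ ε) → |x o - 1| ≤ ε) ∧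
      ((|x a| ≤ ε ∨ |x b| ≤ ε) → |x o| ≤ ε)
  | .lnot i o =>
      (|x i| ≤ ε → |x o - 1| ≤ ε) ∧ (|x i - 1| ≤ ε → |x o| ≤ ε)


/-! ### A cubical Sperner-type lemma (mod 2 cup products) -/

namespace GC

variable {V : Type*} [DecidableEq V]

/-- one step in direction `k` -/
def st (p : V → ℕ) (k : V) : V → ℕ := Function.update p k (p k + 1)

theorem st_comm (p : V → ℕ) (j k : V) : st (st p j) k = st (st p k) j := by
  by_cases h : j = k
  · subst h; rfl
  · funext i
    simp only [st, Function.update_apply]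
    have h' : k ≠ j := fun e => h e.symm
    by_cases h1 : i = k <;> by_cases h2 : i = j <;> simp_all

/-- cup product of the coboundaries of the labels in the list, on the cube at `p` spanned by `S` -/
def C (l : V → (V → ℕ) → ZMod 2) : List V → Finset V → (V → ℕ) → ZMod 2
  | [], _, _ => 1
  | m :: ms, S, p => ∑ k ∈ S, (l m (st p k) + l m p) * C l ms (S.erase k) (st p k)

theorem sum_symm_zero (S : Finset V) (g : V → V → ZMod 2) (hg : ∀ i j, g i j = g j i) :
    ∑ k ∈ S, ∑ j ∈ S.erase k, g k j = 0 := by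
  induction S using Finset.induction_on with
  | empty => simp
  | insert a S ha ih =>
    rw [Finset.sum_insert ha, Finset.erase_insert ha]
    have : ∀ k ∈ S, ∑ j ∈ (insert a S).erase k, g k j = g k a + ∑ j ∈ S.erase k, g k j := by
      intro k hk
      have hne : a ≠ k := fun e => ha (e ▸ hk)
      rw [Finset.erase_insert_of_ne hne, Finset.sum_insert]
      simp [ha]
    rw [Finset.sum_congr rfl this, Finset.sum_add_distrib, ih, add_zero]
    rw [Finset.sum_congr rfl (fun k _ => hg a k)]
    exact CharTwo.add_self_eq_zero _

theorem closed (l : V → (V → ℕ) → ZMod 2) (ls : List V) :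
    ∀ (S : Finset V) (p : V → ℕ), S.card = ls.length + 1 →
      ∑ k ∈ S, (C l ls (S.erase k) (st p k) + C l ls (S.erase k) p) = 0 := by
  induction ls with
  | nil =>
    intro S p hS
    simp only [C]
    exact Finset.sum_eq_zero (fun _ _ => CharTwo.add_self_eq_zero _)
  | cons m ms ih =>
    intro S p hS
    have hc : ∀ j ∈ S, (S.erase j).card = ms.length + 1 := by
      intro j hj
      rw [Finset.card_erase_of_mem hj, hS]; simp
    have swap : ∀ g : V → V → ZMod 2, ∑ k ∈ S, ∑ j ∈ S.erase k, g k j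
        = ∑ k ∈ S, ∑ j ∈ S.erase k, g j k := by
      intro g
      apply Finset.sum_comm'
      intro x y
      simp only [Finset.mem_erase]
      constructor
      · rintro ⟨a, b, c⟩; exact ⟨⟨fun e => b e.symm, a⟩, c⟩
      · rintro ⟨⟨a, b⟩, c⟩; exact ⟨b, fun e => a e.symm, c⟩
    let D : V → V → (V → ℕ) → ZMod 2 := fun k j q => C l ms ((S.erase k).erase j) q
    have hD : ∀ k j q, D k j q = D j k q := by
      intro k j q; simp only [D]; rw [Finset.erase_right_comm]
    have h1 : ∑ k ∈ S, ∑ j ∈ S.erase k, l m (st (st p k) j) * D k j (st (st p k) j) = 0 :=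
      sum_symm_zero S (fun k j => l m (st (st p k) j) * D k j (st (st p k) j))
        (fun i j => by rw [st_comm, hD])
    have h2 : ∑ k ∈ S, ∑ j ∈ S.erase k, D k j p = 0 :=
      sum_symm_zero S (fun k j => D k j p) (fun i j => hD i j p)
    have h3 : ∑ k ∈ S, ∑ j ∈ S.erase k, (D k j (st p j) + D k j p) = 0 :=
      Finset.sum_eq_zero (fun k hk => ih (S.erase k) p (hc k hk))
    have h4 : ∑ k ∈ S, ∑ j ∈ S.erase k,
        l m (st p k) * (D k j (st (st p k) j) + D k j (st p k)) = 0 := by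
      apply Finset.sum_eq_zero
      intro k hk
      rw [← Finset.mul_sum, ih (S.erase k) (st p k) (hc k hk), mul_zero]
    have h5 : ∑ k ∈ S, ∑ j ∈ S.erase k, l m (st p j) * D k j (st p j)
        = ∑ k ∈ S, ∑ j ∈ S.erase k, l m (st p k) * D k j (st p k) := by
      rw [swap]
      refine Finset.sum_congr rfl fun k _ => Finset.sum_congr rfl fun j _ => ?_
      rw [hD]
    have e : ∑ k ∈ S, (C l (m :: ms) (S.erase k) (st p k) + C l (m :: ms) (S.erase k) p)
      = ∑ k ∈ S, ∑ j ∈ S.erase k, l m (st (st p k) j) * D k j (st (st p k) j)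
        + ∑ k ∈ S, ∑ j ∈ S.erase k, l m (st p k) * D k j (st (st p k) j)
        + ∑ k ∈ S, ∑ j ∈ S.erase k, l m (st p j) * D k j (st p j)
        + l m p * ∑ k ∈ S, ∑ j ∈ S.erase k, D k j (st p j) := by
      simp only [C, Finset.mul_sum, ← Finset.sum_add_distrib, D]
      refine Finset.sum_congr rfl fun k _ => Finset.sum_congr rfl fun j _ => ?_
      ring
    simp only [mul_add, Finset.sum_add_distrib] at h3 h4
    rw [h2, add_zero] at h3
    rw [e, h1, h5, h3, mul_zero, zero_add, add_zero, h4]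

/-- On a cube on which the label `k` is constant, the cup product vanishes. -/
theorem C_const (l : V → (V → ℕ) → ZMod 2) (k : V) (c : ZMod 2) (ls : List V) :
    ∀ (S : Finset V) (p : V → ℕ), k ∈ ls →
      (∀ q : V → ℕ, (∀ i, p i ≤ q i) → (∀ i ∈ S, q i ≤ p i + 1) → (∀ i ∉ S, q i = p i) →
        l k q = c) → C l ls S p = 0 := by
  induction ls with
  | nil => intro S p hk; simp at hk
  | cons m ms ih =>
    intro S p hk h
    simp only [C]
    apply Finset.sum_eq_zero
    intro j hj
    have hst : ∀ i, st p j i = if i = j then p j + 1 else p i := by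
      intro i; simp [st, Function.update_apply]
    by_cases hm : k = m
    · subst hm
      rw [h p (fun _ => le_rfl) (fun _ _ => Nat.le_succ _) (fun _ _ => rfl), h (st p j)]
      · rw [CharTwo.add_self_eq_zero, zero_mul]
      · intro i; rw [hst]; split_ifs with e
        · subst e; omega
        · exact le_rfl
      · intro i _; rw [hst]; split_ifs with e
        · subst e; omega
        · omega
      · intro i hi; rw [hst, if_neg]; rintro rfl; exact hi hj
    · rw [ih (S.erase j) (st p j), mul_zero]
      · simpa [hm] using hk
      · intro q h1 h2 h3
        apply h q
        · intro i
          have := h1 i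
          rw [hst] at this
          split_ifs at this with e
          · subst e; omega
          · exact this
        · intro i hi
          by_cases e : i = j
          · have := h3 i (by simp [e])
            rw [hst, if_pos e] at this
            subst e; omega
          · have := h2 i (Finset.mem_erase.2 ⟨e, hi⟩)
            rwa [hst, if_neg e] at this
        · intro i hi
          have e : i ≠ j := by rintro rfl; exact hi hj
          have := h3 i (fun hh => hi (Finset.mem_of_mem_erase hh))
          rwa [hst, if_neg e] at this

variable [Fintype V]

/-- grid points -/
def box (N : ℕ) (S : Finset V) : Finset (V → ℕ) :=
  Fintype.piFinset (fun k => if k ∈ S then Finset.range N else {N})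

theorem mem_box {N : ℕ} {S : Finset V} {p : V → ℕ} :
    p ∈ box N S ↔ ∀ k, (k ∈ S → p k < N) ∧ (k ∉ S → p k = N) := by
  simp only [box, Fintype.mem_piFinset]
  refine forall_congr' fun k => ?_
  by_cases h : k ∈ S <;> simp [h]

theorem sum_box (N : ℕ) (S : Finset V) (k : V) (hk : k ∈ S) (f : (V → ℕ) → ZMod 2) :
    ∑ p ∈ box N S, f p
      = ∑ q ∈ box N (S.erase k), ∑ t ∈ Finset.range N, f (Function.update q k t) := by
  rw [← Finset.sum_product']
  refine Finset.sum_bij' (fun p _ => (Function.update p k N, p k))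
    (fun x _ => Function.update x.1 k x.2) ?_ ?_ ?_ ?_ ?_
  · intro p hp
    rw [mem_box] at hp
    rw [Finset.mem_product]
    refine ⟨mem_box.2 fun i => ?_, Finset.mem_range.2 ((hp k).1 hk)⟩
    have := hp i
    by_cases e : i = k
    · subst e; simp
    · simpa [e, Function.update_apply] using this
  · rintro ⟨q, t⟩ hx
    rw [Finset.mem_product, mem_box] at hx
    refine mem_box.2 fun i => ?_
    have := hx.1 i
    have ht := Finset.mem_range.1 hx.2
    by_cases e : i = k
    · subst e; simpa [hk] using ht
    · simpa [e, Function.update_apply] using this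
  · intro p hp; simp
  · rintro ⟨q, t⟩ hx
    rw [Finset.mem_product, mem_box] at hx
    have : q k = N := (hx.1 k).2 (by simp)
    simp [← this]
  · intro p hp; simp

theorem tele (N : ℕ) (S : Finset V) (k : V) (hk : k ∈ S) (G : (V → ℕ) → ZMod 2) :
    ∑ p ∈ box N S, (G (st p k) + G p)
      = ∑ q ∈ box N (S.erase k), (G q + G (Function.update q k 0)) := by
  rw [sum_box N S k hk]
  refine Finset.sum_congr rfl fun q hq => ?_
  have hqk : q k = N := ((mem_box.1 hq) k).2 (by simp)
  have key : ∀ M : ℕ, ∑ t ∈ Finset.range M,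
      (G (st (Function.update q k t) k) + G (Function.update q k t))
      = G (Function.update q k M) + G (Function.update q k 0) := by
    intro M
    induction M with
    | zero => simp [CharTwo.add_self_eq_zero]
    | succ M ih =>
      rw [Finset.sum_range_succ, ih]
      have : st (Function.update q k M) k = Function.update q k (M + 1) := by simp [st]
      rw [this]
      linear_combination CharTwo.add_self_eq_zero (G (Function.update q k M))
  rw [key N]
  congr 2
  simp [← hqk]

theorem total (l : V → (V → ℕ) → ZMod 2) (N : ℕ)
    (h0 : ∀ k p, p k = 0 → l k p = 0) (h1 : ∀ k p, p k = N → l k p = 1) (ls : List V) :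
    ls.Nodup → ∑ p ∈ box N ls.toFinset, C l ls ls.toFinset p = 1 := by
  induction ls with
  | nil =>
    intro _
    have : box N (([] : List V).toFinset) = {fun _ => N} := by
      ext p; simp [mem_box, funext_iff]
    rw [this]; simp [C]
  | cons m ms ih =>
    intro hnd
    have hnd' := List.nodup_cons.1 hnd
    set S := (m :: ms).toFinset with hS
    have hcard : S.card = ms.length + 1 := by
      rw [hS, List.toFinset_card_of_nodup hnd]; simp
    have hmS : m ∈ S := by simp [hS]
    have herase : S.erase m = ms.toFinset := by
      rw [hS, List.toFinset_cons, Finset.erase_insert]; simpa using hnd'.1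
    let G : V → (V → ℕ) → ZMod 2 := fun k q => l m q * C l ms (S.erase k) q
    have hC : ∀ p, C l (m :: ms) S p = ∑ k ∈ S, (G k (st p k) + G k p) := by
      intro p
      have hc := closed l ms S p hcard
      have e : ∑ k ∈ S, (G k (st p k) + G k p) = C l (m :: ms) S p
          - l m p * ∑ k ∈ S, (C l ms (S.erase k) (st p k) + C l ms (S.erase k) p)
          + (l m p + l m p) * ∑ k ∈ S, C l ms (S.erase k) p := by
        simp only [C, G, Finset.mul_sum, ← Finset.sum_add_distrib, ← Finset.sum_sub_distrib]
        refine Finset.sum_congr rfl fun k _ => ?_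
        ring
      rw [e, hc, CharTwo.add_self_eq_zero]; ring
    rw [Finset.sum_congr rfl (fun p _ => hC p), Finset.sum_comm,
      Finset.sum_congr rfl (fun k hk => tele N S k hk (G k)),
      Finset.sum_eq_single_of_mem m hmS]
    · rw [herase, ← ih hnd'.2]
      refine Finset.sum_congr rfl fun q hq => ?_
      have hqm : q m = N := ((mem_box.1 hq) m).2 (by simpa using hnd'.1)
      simp only [G]
      rw [h1 m q hqm, h0 m (Function.update q m 0) (by simp), herase]; ring
    · intro k hk hkm
      have hkms : k ∈ ms := by
        have : k ∈ m :: ms := by simpa [hS] using hk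
        simpa [hkm] using this
      apply Finset.sum_eq_zero
      intro q hq
      have hqk : q k = N := ((mem_box.1 hq) k).2 (by simp)
      simp only [G]
      rw [C_const l k 1 ms (S.erase k) q hkms, C_const l k 0 ms (S.erase k) _ hkms]
      · ring
      · intro r _ _ h3
        apply h0; rw [h3 k (by simp)]; simp
      · intro r _ _ h3
        apply h1; rw [h3 k (by simp), hqk]

theorem kuhn (l : V → (V → ℕ) → ZMod 2) (N : ℕ)
    (h0 : ∀ k p, p k = 0 → l k p = 0) (h1 : ∀ k p, p k = N → l k p = 1) :
    ∃ p : V → ℕ, (∀ i, p i < N) ∧ ∀ k, ∀ c : ZMod 2,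
      ∃ q : V → ℕ, (∀ i, p i ≤ q i ∧ q i ≤ p i + 1) ∧ l k q ≠ c := by
  have ht := total l N h0 h1 (Finset.univ : Finset V).toList (Finset.nodup_toList _)
  rw [Finset.toList_toFinset] at ht
  obtain ⟨p, hp, hne⟩ := Finset.exists_ne_zero_of_sum_ne_zero (by rw [ht]; exact one_ne_zero)
  refine ⟨p, fun i => ((mem_box.1 hp) i).1 (Finset.mem_univ i), fun k c => ?_⟩
  by_contra! hcon
  apply hne
  apply C_const l k c _ _ _ (by simp)
  intro q ha hb _
  exact hcon q fun i => ⟨ha i, hb i (Finset.mem_univ i)⟩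

/-- Approximate Brouwer fixed point theorem on the cube. -/
theorem approx_brouwer (f : (V → ℝ) → V → ℝ) (hf : Continuous f)
    (hf01 : ∀ x v, f x v ∈ Set.Icc (0 : ℝ) 1) (ε : ℝ) (hε : 0 < ε) :
    ∃ x : V → ℝ, (∀ v, x v ∈ Set.Icc (0 : ℝ) 1) ∧ ∀ v, |x v - f x v| ≤ ε := by
  classical
  have hK : IsCompact (Set.Icc (0 : V → ℝ) 1) := isCompact_Icc
  have hu := hK.uniformContinuousOn_of_continuous hf.continuousOn
  obtain ⟨δ, hδ, hfδ⟩ := Metric.uniformContinuousOn_iff.1 hu (ε / 2) (by positivity)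
  obtain ⟨n, hn⟩ := exists_nat_one_div_lt (lt_min hδ (half_pos hε))
  set N := n + 1 with hN
  have hNpos : (0 : ℝ) < N := by rw [hN]; positivity
  have hn' : (1 : ℝ) / N < min δ (ε / 2) := by rw [hN]; push_cast; exact hn
  let X : (V → ℕ) → V → ℝ := fun q v => (q v : ℝ) / N
  let l : V → (V → ℕ) → ZMod 2 := fun k q => if q k ≠ 0 ∧ f (X q) k ≤ X q k then 1 else 0
  obtain ⟨p, hpN, hp⟩ := kuhn l N
    (by intro k q h; simp [l, h])
    (by
      intro k q h
      have : X q k = 1 := by simp only [X, h]; exact div_self hNpos.ne'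
      simp only [l]
      rw [if_pos]
      rw [this]
      exact ⟨by omega, (hf01 _ _).2⟩)
  have hX : ∀ q : V → ℕ, (∀ i, q i ≤ N) → X q ∈ Set.Icc (0 : V → ℝ) 1 := by
    intro q hq
    constructor
    · intro i; simp only [X, Pi.zero_apply]; positivity
    · intro i; simp only [X, Pi.one_apply]
      rw [div_le_one hNpos]; exact_mod_cast hq i
  have hXp := hX p (fun i => (hpN i).le)
  refine ⟨X p, fun v => ⟨hXp.1 v, hXp.2 v⟩, fun v => ?_⟩
  have near : ∀ q : V → ℕ, (∀ i, p i ≤ q i ∧ q i ≤ p i + 1) →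
      |f (X q) v - f (X p) v| < ε / 2 ∧ X p v ≤ X q v ∧ X q v ≤ X p v + 1 / N := by
    intro q hq
    have hb : ∀ i, X p i ≤ X q i ∧ X q i ≤ X p i + 1 / N := by
      intro i
      simp only [X]
      rw [← add_div]
      constructor
      · gcongr; exact (hq i).1
      · gcongr; exact_mod_cast (hq i).2
    have hd : dist (X q) (X p) < δ := by
      rw [dist_pi_lt_iff hδ]
      intro i
      rw [Real.dist_eq, abs_of_nonneg (by linarith [(hb i).1])]
      linarith [(hb i).2, min_le_left δ (ε / 2)]
    have h := hfδ (X q) (hX q fun i => by have := (hq i).2; have := hpN i; omega) (X p) hXp hd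
    have h2 := (dist_pi_lt_iff (by positivity)).1 h v
    rw [Real.dist_eq] at h2
    exact ⟨h2, hb v⟩
  obtain ⟨q, hq, hq1⟩ := hp v 0
  obtain ⟨r, hr, hr1⟩ := hp v 1
  obtain ⟨a1, a2, a3⟩ := near q hq
  obtain ⟨b1, b2, b3⟩ := near r hr
  have hq2 : f (X q) v ≤ X q v := by
    by_contra hc
    apply hq1; simp only [l]; rw [if_neg]; tauto
  have hr2 : X r v ≤ f (X r) v := by
    by_contra hc
    apply hr1; simp only [l]; rw [if_pos]
    refine ⟨fun hz => hc ?_, (not_le.1 hc).le⟩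
    have : X r v = 0 := by simp [X, hz]
    rw [this]; exact (hf01 _ _).1
  have hm := min_le_right δ (ε / 2)
  rw [abs_lt] at a1 b1
  rw [abs_le]
  constructor <;> linarith

end GC

/-! ### The gate functions -/

namespace GC

/-- clamp to `[0,1]` -/
noncomputable def clamp (t : ℝ) : ℝ := max 0 (min 1 t)

theorem clamp_mem (t : ℝ) : clamp t ∈ Set.Icc (0 : ℝ) 1 :=
  ⟨le_max_left _ _, max_le zero_le_one (min_le_left _ _)⟩

theorem clamp_hi {t : ℝ} (h : 1 ≤ t) : clamp t = 1 := by
  simp [clamp, min_eq_left h]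

theorem clamp_lo {t : ℝ} (h : t ≤ 0) : clamp t = 0 := by
  rw [clamp, max_eq_left]; exact (min_le_right _ _).trans h

theorem clamp_id {t : ℝ} (h : 0 ≤ t) (h1 : t ≤ 1) : clamp t = t := by
  rw [clamp, min_eq_right h1, max_eq_right h]

theorem clamp_cont : Continuous clamp := by unfold clamp; fun_prop

/-- exact (unclamped) gate value -/
noncomputable def raw {V : Type*} (ε : ℝ) (x : V → ℝ) : Gate V → ℝ
  | .const α _ => α
  | .scale α i _ => α * x i
  | .assign i _ => x i
  | .add a b _ => min (x a + x b) 1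
  | .sub a b _ => max (x a - x b) 0
  | .lt a b _ => 1 / 2 + (x b - x a) / (2 * ε)
  | .lor a b _ => (max (x a) (x b) - ε) / (1 - 2 * ε)
  | .land a b _ => (min (x a) (x b) - ε) / (1 - 2 * ε)
  | .lnot i _ => (1 - ε - x i) / (1 - 2 * ε)

theorem raw_cont {V : Type*} (ε : ℝ) (T : Gate V) : Continuous (fun x => raw ε x T) := by
  cases T <;> simp only [raw] <;> fun_prop

theorem sat_of_raw {V : Type*} (ε : ℝ) (hε : 0 < ε) (hε2 : ε < 1 / 2) (x : V → ℝ)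
    (hx : ∀ v, x v ∈ Set.Icc (0 : ℝ) 1) (T : Gate V) (hT : T.paramOK)
    (h : |x T.out - clamp (raw ε x T)| ≤ ε) : T.sat ε x := by
  have hd : 0 < 1 - 2 * ε := by linarith
  have hi : ∀ {t : ℝ} {o : V}, |x o - clamp t| ≤ ε → 1 ≤ t → |x o - 1| ≤ ε := by
    intro t o h ht; rwa [clamp_hi ht] at h
  have lo : ∀ {t : ℝ} {o : V}, |x o - clamp t| ≤ ε → t ≤ 0 → |x o| ≤ ε := by
    intro t o h ht; rwa [clamp_lo ht, sub_zero] at h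
  cases T with
  | const α o =>
    simp only [Gate.paramOK, Gate.out, raw, Gate.sat] at *
    rwa [clamp_id hT.1 hT.2] at h
  | scale α i o =>
    simp only [Gate.paramOK, Gate.out, raw, Gate.sat] at *
    rwa [clamp_id (mul_nonneg hT.1.le (hx i).1) (mul_le_one₀ hT.2 (hx i).1 (hx i).2)] at h
  | assign i o =>
    simp only [Gate.out, raw, Gate.sat] at *
    rwa [clamp_id (hx i).1 (hx i).2] at h
  | add a b o =>
    simp only [Gate.out, raw, Gate.sat] at *
    rwa [clamp_id (le_min (add_nonneg (hx a).1 (hx b).1) zero_le_one) (min_le_right _ _)] at h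
  | sub a b o =>
    simp only [Gate.out, raw, Gate.sat] at *
    rwa [clamp_id (le_max_right _ _)
      (max_le (by linarith [(hx a).2, (hx b).1]) zero_le_one)] at h
  | lt a b o =>
    simp only [Gate.out, raw, Gate.sat] at *
    constructor
    · intro hab
      refine hi h ?_
      have : 1 / 2 ≤ (x b - x a) / (2 * ε) := by rw [le_div_iff₀ (by positivity)]; linarith
      linarith
    · intro hab
      refine lo h ?_
      have : (x b - x a) / (2 * ε) ≤ -(1 / 2) := by rw [div_le_iff₀ (by positivity)]; linarith
      linarith
  | lor a b o =>
    simp only [Gate.out, raw, Gate.sat] at h ⊢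
    constructor
    · intro hab
      refine hi h ?_
      simp only [abs_le] at hab
      rw [le_div_iff₀ hd]
      have := le_max_left (x a) (x b)
      have := le_max_right (x a) (x b)
      rcases hab with hab | hab <;> linarith [hab.1]
    · intro hab
      refine lo h (div_nonpos_of_nonpos_of_nonneg ?_ hd.le)
      simp only [abs_le] at hab
      linarith [max_le hab.1.2 hab.2.2]
  | land a b o =>
    simp only [Gate.out, raw, Gate.sat] at h ⊢
    constructor
    · intro hab
      refine hi h ?_
      simp only [abs_le] at hab
      rw [le_div_iff₀ hd]
      have : 1 - ε ≤ min (x a) (x b) :=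
        le_min (by linarith [hab.1.1]) (by linarith [hab.2.1])
      linarith
    · intro hab
      refine lo h (div_nonpos_of_nonpos_of_nonneg ?_ hd.le)
      simp only [abs_le] at hab
      have := min_le_left (x a) (x b)
      have := min_le_right (x a) (x b)
      rcases hab with hab | hab <;> linarith [hab.2]
  | lnot i o =>
    simp only [Gate.out, raw, Gate.sat] at *
    constructor
    · intro hab
      refine hi h ?_
      rw [le_div_iff₀ hd]
      linarith [(abs_le.1 hab).2]
    · intro hab
      refine lo h (div_nonpos_of_nonpos_of_nonneg ?_ hd.le)
      linarith [(abs_le.1 hab).1]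

theorem sat_half {V : Type*} (ε : ℝ) (hε2 : 1 / 2 ≤ ε) (T : Gate V) (hT : T.paramOK) :
    T.sat ε (fun _ => 1 / 2) := by
  have e1 : |(1 / 2 : ℝ) - 1| ≤ ε := by rw [abs_le]; constructor <;> linarith
  have e2 : |(1 / 2 : ℝ)| ≤ ε := by rw [abs_le]; constructor <;> linarith
  cases T with
  | const α o =>
    simp only [Gate.paramOK, Gate.sat] at *
    rw [abs_le]; constructor <;> linarith [hT.1, hT.2]
  | scale α i o =>
    simp only [Gate.paramOK, Gate.sat] at *
    rw [abs_le]; constructor <;> linarith [hT.1, hT.2]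
  | assign i o => simp only [Gate.sat, sub_self, abs_zero]; linarith
  | add a b o => simp only [Gate.sat]; norm_num at *; linarith
  | sub a b o => simp only [Gate.sat]; norm_num at *; linarith
  | lt a b o => exact ⟨fun _ => e1, fun _ => e2⟩
  | lor a b o => exact ⟨fun _ => e1, fun _ => e2⟩
  | land a b o => exact ⟨fun _ => e1, fun _ => e2⟩
  | lnot i o => exact ⟨fun _ => e1, fun _ => e2⟩

end GC

/-- **Every generalized circuit instance has an ε-approximate solution.** For any finite
set of nodes `V`, any list of gates with admissible parameters in which each node is the
output of at most one gate, and any `ε > 0`, there is an assignment `x ∈ [0,1]^V`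
satisfying all the `ε`-approximate gate constraints. -/
theorem gcircuit_solution_exists (V : Type*) [Fintype V]
    (gates : List (Gate V))
    (hparam : ∀ T ∈ gates, T.paramOK)
    (hout : gates.Pairwise (fun T T' => T.out ≠ T'.out))
    (ε : ℝ) (hε : 0 < ε) :
    ∃ x : V → ℝ, (∀ v, x v ∈ Set.Icc (0 : ℝ) 1) ∧ ∀ T ∈ gates, T.sat ε x := by
  classical
  by_cases hε2 : 1 / 2 ≤ ε
  · exact ⟨fun _ => 1 / 2, fun _ => ⟨by norm_num, by norm_num⟩,
      fun T hT => GC.sat_half ε hε2 T (hparam T hT)⟩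
  · push Not at hε2
    have huniq : ∀ T ∈ gates, ∀ T' ∈ gates, T.out = T'.out → T = T' := by
      intro T hT T' hT' he
      by_contra hne
      haveI : Std.Symm (fun T T' : Gate V => T.out ≠ T'.out) := ⟨fun _ _ h => h.symm⟩
      exact hout.forall hT hT' hne he
    let f : (V → ℝ) → V → ℝ := fun x v =>
      if h : ∃ T ∈ gates, T.out = v then GC.clamp (GC.raw ε x h.choose) else 0
    have hf : Continuous f := by
      refine continuous_pi fun v => ?_
      by_cases h : ∃ T ∈ gates, T.out = v
      · simp only [f, dif_pos h]
        exact GC.clamp_cont.comp (GC.raw_cont ε _)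
      · simp only [f, dif_neg h]
        exact continuous_const
    have hf01 : ∀ x v, f x v ∈ Set.Icc (0 : ℝ) 1 := by
      intro x v
      simp only [f]
      split_ifs
      · exact GC.clamp_mem _
      · simp
    obtain ⟨x, hx, hfx⟩ := GC.approx_brouwer f hf hf01 ε hε
    refine ⟨x, hx, fun T hT => GC.sat_of_raw ε hε hε2 x hx T (hparam T hT) ?_⟩
    have h : ∃ T' ∈ gates, T'.out = T.out := ⟨T, hT, rfl⟩
    have hc : h.choose = T := huniq _ h.choose_spec.1 _ hT h.choose_spec.2
    have := hfx T.out
    simp only [f, dif_pos h] at this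
    rwa [hc] at this
end
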